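/- arXiv:2509.07536 — 2 statements merged into one kernel-verified Lean document; each statement's English description precedes it below -/
import Mathlib

section
/- Let ω be a radial weight in the class D̂, let N∈ℕ, α>0, and set μ = ω·ω̂^{α−1}. Let K=K(ω)>1 be such that the sequence M_n = ⌊1/(1−r_n)⌋ (with r_n = inf{r∈[0,1): ω̂(r)=ω̂(0)K^{−n}}) is lacunary, and let {P_n}_{n≥0} be a sequence of polynomials such that the Taylor coefficient P̂_n(j)=0 for all j∉[M_{n−1}, M_{n+N}) (with M_{−1}=0). Then for every admissible Banach space X containing all polynomials there exist constants c,C>0 such that for all n∈ℕ∪{0} and all g∈H(D): c·K^{−αn}·‖P_n∗g‖_X ≤ ‖I^μ(P_n∗g)‖_X ≤ C·K^{−αn}·‖P_n∗g‖_X, and likewise c·μ_{M_n}·‖P_n∗g‖_X ≤ ‖I^μ(P_n∗g)‖_X ≤ C·μ_{M_n}·‖P_n∗g‖_X. -/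
open MeasureTheory Filter Set
open scoped ENNReal

noncomputable section

/-- `ω̂(r) = ∫_r^1 ω(s) ds`. -/
def omegaHat (ω : ℝ → ℝ) (r : ℝ) : ℝ := ∫ s in r..1, ω s

/-- A radial weight: nonnegative and Lebesgue integrable on `[0,1)`. -/
def IsRadialWeight (ω : ℝ → ℝ) : Prop :=
  (∀ r ∈ Set.Ico (0:ℝ) 1, 0 ≤ ω r) ∧ MeasureTheory.IntegrableOn ω (Set.Ico 0 1)

/-- The class `D̂` of upper doubling radial weights. -/
def InDhat (ω : ℝ → ℝ) : Prop :=
  ∃ C > (0:ℝ), ∀ r ∈ Set.Ico (0:ℝ) 1, omegaHat ω r ≤ C * omegaHat ω ((1 + r) / 2)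

/-- The class `Ď`. -/
def InDcheck (ω : ℝ → ℝ) : Prop :=
  ∃ K > (1:ℝ), ∃ C > (1:ℝ), ∀ r ∈ Set.Ico (0:ℝ) 1,
    C * omegaHat ω (1 - (1 - r) / K) ≤ omegaHat ω r

/-- Moments `μ_x = ∫_0^1 r^x μ(r) dr`. -/
def momentW (μ : ℝ → ℝ) (x : ℝ) : ℝ := ∫ r in (0:ℝ)..1, r ^ x * μ r

/-- The coefficients `μ_{2k+1}` of the `A²_μ` pairing. -/
def momentCoeff (μ : ℝ → ℝ) : ℕ → ℝ := fun k => momentW μ (2 * (k:ℝ) + 1)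

/-- The point `r e^{iθ}` of the circle of radius `r`. -/
def circlePt (r θ : ℝ) : ℂ := (r:ℂ) * Complex.exp ((θ:ℂ) * Complex.I)

/-- Integral means `M_p(r,f)` (with values in `[0,∞]`). -/
def MpE (p r : ℝ) (f : ℂ → ℂ) : ℝ≥0∞ :=
  (ENNReal.ofReal (1 / (2 * Real.pi)) *
    ∫⁻ θ in Set.Ioo (0:ℝ) (2 * Real.pi), ENNReal.ofReal (‖f (circlePt r θ)‖ ^ p)) ^ (1 / p)

/-- Integral means of a `[0,∞]`-valued function. -/
def MpEE (p r : ℝ) (F : ℂ → ℝ≥0∞) : ℝ≥0∞ :=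
  (ENNReal.ofReal (1 / (2 * Real.pi)) *
    ∫⁻ θ in Set.Ioo (0:ℝ) (2 * Real.pi), (F (circlePt r θ)) ^ p) ^ (1 / p)

/-- The norm of the mixed norm space `L^{p,q}_ω`. -/
def LpqNormE (ω : ℝ → ℝ) (p q : ℝ) (f : ℂ → ℂ) : ℝ≥0∞ :=
  (∫⁻ r in Set.Ioo (0:ℝ) 1, (MpE p r f) ^ q * ENNReal.ofReal (r * ω r)) ^ (1 / q)

/-- The `L^{p,q}_ω` norm of a `[0,∞]`-valued function. -/
def LpqNormEE (ω : ℝ → ℝ) (p q : ℝ) (F : ℂ → ℝ≥0∞) : ℝ≥0∞ :=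
  (∫⁻ r in Set.Ioo (0:ℝ) 1, (MpEE p r F) ^ q * ENNReal.ofReal (r * ω r)) ^ (1 / q)

/-- The norm of `A^{p,∞}_ω` : `sup_{0 ≤ r < 1} M_p(r,f) ω̂(r)`. -/
def ApInfNormE (ω : ℝ → ℝ) (p : ℝ) (f : ℂ → ℂ) : ℝ≥0∞ :=
  ⨆ r ∈ Set.Ico (0:ℝ) 1, MpE p r f * ENNReal.ofReal (omegaHat ω r)

/-- Membership in the mixed norm space `A^{p,q}_ω`. -/
def InApq (ω : ℝ → ℝ) (p q : ℝ) (f : ℂ → ℂ) : Prop :=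
  DifferentiableOn ℂ f (Metric.ball 0 1) ∧ LpqNormE ω p q f < ⊤

/-- Membership in `A^{p,∞}_ω`. -/
def InApInf (ω : ℝ → ℝ) (p : ℝ) (f : ℂ → ℂ) : Prop :=
  DifferentiableOn ℂ f (Metric.ball 0 1) ∧ ApInfNormE ω p f < ⊤

/-- Taylor coefficient of `f` at `0`. -/
def taylorCoeff (f : ℂ → ℂ) (n : ℕ) : ℂ := iteratedDeriv n f 0 / (n.factorial : ℂ)

/-- The pairing `⟨f,g⟩ = lim_{r→1⁻} ∑_k f̂(k) conj(ĝ(k)) c(k) r^k` exists and equals `l`. -/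
def HasPairingC (c : ℕ → ℝ) (f g : ℂ → ℂ) (l : ℂ) : Prop :=
  (∀ r ∈ Set.Ico (0:ℝ) 1, Summable (fun k : ℕ =>
    taylorCoeff f k * (starRingEnd ℂ) (taylorCoeff g k) * ((c k : ℝ) : ℂ) * ((r:ℂ)) ^ k)) ∧
  Filter.Tendsto (fun r : ℝ => ∑' k : ℕ,
    taylorCoeff f k * (starRingEnd ℂ) (taylorCoeff g k) * ((c k : ℝ) : ℂ) * ((r:ℂ)) ^ k)
    (nhdsWithin 1 (Set.Iio 1)) (nhds l)

/-- `L` is linear on the functions satisfying `P`. -/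
def IsLinearOn (P : (ℂ → ℂ) → Prop) (L : (ℂ → ℂ) → ℂ) : Prop :=
  (∀ f g : ℂ → ℂ, P f → P g → L (f + g) = L f + L g) ∧
  (∀ (c : ℂ) (f : ℂ → ℂ), P f → L (c • f) = c * L f)

/-- Dilation `f_r(z) = f(rz)`. -/
def dilateF (f : ℂ → ℂ) (r : ℝ) : ℂ → ℂ := fun z => f ((r:ℂ) * z)

/-- The BMOA norm `|f(0)| + sup_{a∈D} sup_{0<r<1} M₂(r, f∘φ_a - f(a))`. -/
def BMOANormE (f : ℂ → ℂ) : ℝ≥0∞ :=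
  ENNReal.ofReal ‖f 0‖ +
    ⨆ a ∈ Metric.ball (0:ℂ) 1, ⨆ r ∈ Set.Ioo (0:ℝ) 1,
      MpE 2 r (fun z => f ((a - z) / (1 - (starRingEnd ℂ) a * z)) - f a)

/-- The Bloch norm `|f(0)| + sup_{z∈D} (1-|z|²)|f'(z)|`. -/
def BlochNormE (f : ℂ → ℂ) : ℝ≥0∞ :=
  ENNReal.ofReal ‖f 0‖ +
    ⨆ z ∈ Metric.ball (0:ℂ) 1, ENNReal.ofReal ((1 - ‖z‖ ^ 2) * ‖deriv f z‖)

/-- The norm of `X(q,ω)`: `(∫_0^1 ‖f_r‖_X^q ω(r) dr)^{1/q}`. -/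
def XqNormE (Xnorm : (ℂ → ℂ) → ℝ≥0∞) (ω : ℝ → ℝ) (q : ℝ) (f : ℂ → ℂ) : ℝ≥0∞ :=
  (∫⁻ r in Set.Ioo (0:ℝ) 1, (Xnorm (dilateF f r)) ^ q * ENNReal.ofReal (ω r)) ^ (1 / q)

/-- The norm of `X(∞,ω)`: `sup_{0<r<1} ‖f_r‖_X ω̂(r)`. -/
def XInfNormE (Xnorm : (ℂ → ℂ) → ℝ≥0∞) (ω : ℝ → ℝ) (f : ℂ → ℂ) : ℝ≥0∞ :=
  ⨆ r ∈ Set.Ioo (0:ℝ) 1, Xnorm (dilateF f r) * ENNReal.ofReal (omegaHat ω r)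

/-- The standard radial weight `ν_β(r) = (β+1)(1-r²)^β`. -/
def nuWeight (β : ℝ) : ℝ → ℝ := fun r => (β + 1) * (1 - r ^ 2) ^ β

/-- The Bergman reproducing kernel `B^ω_a(z) = ∑ (z conj a)^n / (2 ω_{2n+1})`. -/
def bergmanKernel (ω : ℝ → ℝ) (a z : ℂ) : ℂ :=
  ∑' n : ℕ, (z * (starRingEnd ℂ) a) ^ n / (2 * ((momentW ω (2 * (n:ℝ) + 1) : ℝ) : ℂ))

/-- The Bergman projection (`dA` is normalized area measure). -/
def PomegaProj (ω : ℝ → ℝ) (f : ℂ → ℂ) (z : ℂ) : ℂ :=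
  (Real.pi)⁻¹ • ∫ ζ in Metric.ball (0:ℂ) 1,
    f ζ * (starRingEnd ℂ) (bergmanKernel ω z ζ) * ((ω ‖ζ‖ : ℝ) : ℂ)

/-- The maximal Bergman projection applied to `|f|`, with values in `[0,∞]`. -/
def PomegaPlusL (ω : ℝ → ℝ) (f : ℂ → ℂ) (z : ℂ) : ℝ≥0∞ :=
  ∫⁻ ζ in Metric.ball (0:ℂ) 1,
    ENNReal.ofReal (‖f ζ‖ * ‖bergmanKernel ω z ζ‖ * ω ‖ζ‖ / Real.pi)

/-- The Hardy `H¹` norm. -/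
def H1NormE (f : ℂ → ℂ) : ℝ≥0∞ := ⨆ r ∈ Set.Ioo (0:ℝ) 1, MpE 1 r f

/-- `r_n = inf{ r ∈ [0,1) : ω̂(r) = ω̂(0) K^{-n} }`. -/
def rSeq (ω : ℝ → ℝ) (K : ℝ) (n : ℕ) : ℝ :=
  sInf {r | r ∈ Set.Ico (0:ℝ) 1 ∧ omegaHat ω r = omegaHat ω 0 * K ^ (-(n:ℝ))}

/-- `M_n = ⌊1/(1-r_n)⌋`. -/
def MSeq (ω : ℝ → ℝ) (K : ℝ) (n : ℕ) : ℕ := ⌊1 / (1 - rSeq ω K n)⌋₊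

/-- Weighted Hadamard product of a polynomial with an analytic function:
`z ↦ ∑_j c(j) P̂(j) ĝ(j) z^j`. -/
def hadamardPolyC (c : ℕ → ℂ) (P : Polynomial ℂ) (g : ℂ → ℂ) : ℂ → ℂ :=
  fun z => ∑ j ∈ Finset.range (P.natDegree + 1), c j * P.coeff j * taylorCoeff g j * z ^ j

/-- An admissible Banach space of analytic functions on the unit disc, given by a
carrier set and a norm function. -/
structure AdmissibleSpace where
  carrier : Set (ℂ → ℂ)
  nrm : (ℂ → ℂ) → ℝ
  mem_analytic : ∀ f ∈ carrier, DifferentiableOn ℂ f (Metric.ball 0 1)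
  zero_mem : (0 : ℂ → ℂ) ∈ carrier
  add_mem : ∀ f g : ℂ → ℂ, f ∈ carrier → g ∈ carrier → f + g ∈ carrier
  smul_mem : ∀ (c : ℂ) (f : ℂ → ℂ), f ∈ carrier → c • f ∈ carrier
  nrm_nonneg : ∀ f ∈ carrier, 0 ≤ nrm f
  nrm_eq_zero : ∀ f ∈ carrier, nrm f = 0 → ∀ z ∈ Metric.ball (0:ℂ) 1, f z = 0
  nrm_add : ∀ f g : ℂ → ℂ, f ∈ carrier → g ∈ carrier → nrm (f + g) ≤ nrm f + nrm g
  nrm_smul : ∀ (c : ℂ) (f : ℂ → ℂ), f ∈ carrier → nrm (c • f) = ‖c‖ * nrm f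
  complete : ∀ u : ℕ → (ℂ → ℂ), (∀ n, u n ∈ carrier) →
    (∀ ε : ℝ, 0 < ε → ∃ N : ℕ, ∀ m ≥ N, ∀ n ≥ N, nrm (u m - u n) < ε) →
    ∃ f ∈ carrier, Filter.Tendsto (fun n => nrm (u n - f)) Filter.atTop (nhds 0)
  norm_conv_implies_ucc : ∀ (u : ℕ → (ℂ → ℂ)) (f : ℂ → ℂ),
    (∀ n, u n ∈ carrier) → f ∈ carrier →
    Filter.Tendsto (fun n => nrm (u n - f)) Filter.atTop (nhds 0) →
    ∀ Kc : Set ℂ, Kc ⊆ Metric.ball 0 1 → IsCompact Kc →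
      TendstoUniformlyOn (fun n => u n) f Filter.atTop Kc
  ucc_implies_norm_conv : ∀ R : ℝ, 1 < R → ∀ (u : ℕ → (ℂ → ℂ)) (f : ℂ → ℂ),
    (∀ n, u n ∈ carrier ∧ DifferentiableOn ℂ (u n) (Metric.ball 0 R)) →
    DifferentiableOn ℂ f (Metric.ball 0 R) →
    (∀ Kc : Set ℂ, Kc ⊆ Metric.ball (0:ℂ) R → IsCompact Kc →
      TendstoUniformlyOn (fun n => u n) f Filter.atTop Kc) →
    f ∈ carrier ∧ Filter.Tendsto (fun n => nrm (u n - f)) Filter.atTop (nhds 0)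
  dilation_bound : ∃ C > (0:ℝ), ∀ f ∈ carrier, ∀ ζ : ℂ, ‖ζ‖ ≤ 1 →
    (fun z => f (ζ * z)) ∈ carrier ∧ nrm (fun z => f (ζ * z)) ≤ C * nrm f

/-- The operator `T_p = I^{ν_{1/p-2}}`. -/
def TpOp (p : ℝ) (g : ℂ → ℂ) : ℂ → ℂ :=
  fun z => ∑' k : ℕ,
    taylorCoeff g k * ((momentW (nuWeight (1 / p - 2)) (2 * (k:ℝ) + 1) : ℝ) : ℂ) * z ^ k

/-- Membership in the Bloch space. -/
def InBloch (g : ℂ → ℂ) : Prop :=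
  DifferentiableOn ℂ g (Metric.ball 0 1) ∧ BlochNormE g < ⊤

open Classical in
/-- The norm of the space `X_p = T_p(B)`, normed so that `T_p` is an isometry. -/
def XpNormE (p : ℝ) (h : ℂ → ℂ) : ℝ≥0∞ :=
  if H : ∃ g : ℂ → ℂ, InBloch g ∧ Set.EqOn h (TpOp p g) (Metric.ball 0 1)
  then BlochNormE H.choose else ⊤

/-- The polynomial `V_n ∗ g` where `V_n(z) = ∑_{j=2^{n-1}}^{2^{n+1}-1} ψ(j/2^{n-1}) z^j`
and `ψ(t) = Ψ(t/2) - Ψ(t)`. -/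
def VnStar (Ψ : ℝ → ℝ) (n : ℕ) (g : ℂ → ℂ) : ℂ → ℂ :=
  fun z => ∑ j ∈ Finset.Icc (2 ^ (n - 1) : ℕ) (2 ^ (n + 1) - 1 : ℕ),
    (((Ψ ((j:ℝ) / 2 ^ n) - Ψ ((j:ℝ) / 2 ^ (n - 1))) : ℝ) : ℂ) * taylorCoeff g j * z ^ j

/-- `D^ω(V_n ∗ g)`, where `D^ω h(z) = ∑ ĥ(k) z^k/(2ω_{2k+1})`. -/
def DVnStar (Ψ : ℝ → ℝ) (ω : ℝ → ℝ) (n : ℕ) (g : ℂ → ℂ) : ℂ → ℂ :=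
  fun z => ∑ j ∈ Finset.Icc (2 ^ (n - 1) : ℕ) (2 ^ (n + 1) - 1 : ℕ),
    (((Ψ ((j:ℝ) / 2 ^ n) - Ψ ((j:ℝ) / 2 ^ (n - 1))) : ℝ) : ℂ) * taylorCoeff g j * z ^ j /
      (2 * ((momentW ω (2 * (j:ℝ) + 1) : ℝ) : ℂ))

/-- `J_ω(t) = ∫_0^t ds/(ω̂(s)(1-s))`. -/
def Jomega (ω : ℝ → ℝ) (t : ℝ) : ℝ := ∫ s in (0:ℝ)..t, 1 / (omegaHat ω s * (1 - s))

theorem AbsolutelyContinuousOnInterval.lipschitzOnWith_comp {f φ : ℝ → ℝ} {a b : ℝ} {s : Set ℝ}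
    {L : NNReal} (hf : AbsolutelyContinuousOnInterval f a b) (hφ : LipschitzOnWith L φ s)
    (hs : MapsTo f (uIcc a b) s) : AbsolutelyContinuousOnInterval (φ ∘ f) a b := by
  have hf' := hf.const_mul (L : ℝ)
  rw [absolutelyContinuousOnInterval_iff] at hf' ⊢
  intro ε hε
  obtain ⟨δ, hδ, h⟩ := hf' ε hε
  refine ⟨δ, hδ, fun E hE hlt => lt_of_le_of_lt (Finset.sum_le_sum fun i hi => ?_) (h E hE hlt)⟩
  have := hφ.dist_le_mul _ (hs (hE.1 i hi).1) _ (hs (hE.1 i hi).2)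
  refine this.trans (le_of_eq ?_)
  rw [Real.dist_eq, Real.dist_eq, ← mul_sub, abs_mul, abs_of_nonneg L.coe_nonneg]

section RadialWeight

variable {ω : ℝ → ℝ}

theorem IsRadialWeight.intervalIntegrable (hω : IsRadialWeight ω) {a b : ℝ} (ha : 0 ≤ a)
    (ha1 : a ≤ 1) (hb : 0 ≤ b) (hb1 : b ≤ 1) : IntervalIntegrable ω volume a b := by
  have h01 : IntervalIntegrable ω volume 0 1 := by
    rw [intervalIntegrable_iff_integrableOn_Ico_of_le zero_le_one]
    exact hω.2
  exact h01.mono_set (by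
    rw [uIcc_of_le zero_le_one]
    exact uIcc_subset_Icc ⟨ha, ha1⟩ ⟨hb, hb1⟩)

theorem omegaHat_sub (hω : IsRadialWeight ω) {a b : ℝ} (ha : 0 ≤ a) (ha1 : a ≤ 1) (hb : 0 ≤ b)
    (hb1 : b ≤ 1) : omegaHat ω a - omegaHat ω b = ∫ s in a..b, ω s := by
  rw [omegaHat, omegaHat, sub_eq_iff_eq_add]
  exact (intervalIntegral.integral_add_adjacent_intervals
    (hω.intervalIntegrable ha ha1 hb hb1)
    (hω.intervalIntegrable hb hb1 zero_le_one le_rfl)).symm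

theorem omegaHat_anti (hω : IsRadialWeight ω) {a b : ℝ} (ha : 0 ≤ a) (hab : a ≤ b)
    (hb : b < 1) : omegaHat ω b ≤ omegaHat ω a := by
  have h := omegaHat_sub hω ha (hab.trans hb.le) (ha.trans hab) hb.le
  have : 0 ≤ ∫ s in a..b, ω s :=
    intervalIntegral.integral_nonneg hab fun s hs => hω.1 s ⟨ha.trans hs.1, hs.2.trans_lt hb⟩
  linarith

theorem omegaHat_eq_neg_primitive (ω : ℝ → ℝ) :
    omegaHat ω = -fun x => ∫ t in (1:ℝ)..x, ω t := by
  funext y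
  rw [Pi.neg_apply, omegaHat, intervalIntegral.integral_symm]

theorem omegaHat_absolutelyContinuous (hω : IsRadialWeight ω) :
    AbsolutelyContinuousOnInterval (omegaHat ω) 0 1 := by
  have h := (hω.intervalIntegrable le_rfl zero_le_one zero_le_one
    le_rfl).absolutelyContinuousOnInterval_intervalIntegral (c := 1) (by simp)
  rw [omegaHat_eq_neg_primitive]
  exact h.neg

theorem omegaHat_continuousOn (hω : IsRadialWeight ω) :
    ContinuousOn (omegaHat ω) (Icc 0 1) := by
  have := (omegaHat_absolutelyContinuous hω).continuousOn
  rwa [uIcc_of_le zero_le_one] at this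

theorem omegaHat_ae_hasDerivAt (hω : IsRadialWeight ω) :
    ∀ᵐ x, x ∈ Icc (0 : ℝ) 1 → HasDerivAt (omegaHat ω) (-ω x) x := by
  have h01 := hω.intervalIntegrable le_rfl zero_le_one zero_le_one le_rfl
  filter_upwards [h01.ae_hasDerivAt_integral] with x hx hx1
  rw [uIcc_of_le zero_le_one] at hx
  have h := (hx hx1 1 (by simp)).neg
  rw [omegaHat_eq_neg_primitive]; exact h

theorem integral_weight_rpow (hω : IsRadialWeight ω)
    (hpos : ∀ r ∈ Set.Ico (0:ℝ) 1, 0 < omegaHat ω r) {α : ℝ} (hα : 0 < α) {a b : ℝ}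
    (ha : 0 ≤ a) (hab : a ≤ b) (hb : b < 1) :
    IntervalIntegrable (fun r => ω r * omegaHat ω r ^ (α - 1)) volume a b ∧
      ∫ r in a..b, ω r * omegaHat ω r ^ (α - 1) =
        (omegaHat ω a ^ α - omegaHat ω b ^ α) / α := by
  have hbpos := hpos b ⟨ha.trans hab, hb⟩
  have hsub : uIcc a b ⊆ Icc 0 1 := by
    rw [uIcc_of_le hab]; exact Icc_subset_Icc ha hb.le
  have hcont : ContinuousOn (omegaHat ω) (uIcc a b) := (omegaHat_continuousOn hω).mono hsub
  have hmaps : MapsTo (omegaHat ω) (uIcc a b) (Icc (omegaHat ω b) (omegaHat ω a)) := by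
    rw [uIcc_of_le hab]
    intro x hx
    exact ⟨omegaHat_anti hω (ha.trans hx.1) hx.2 hb,
      omegaHat_anti hω ha hx.1 (hx.2.trans_lt hb)⟩
  have hne : ∀ x ∈ uIcc a b, omegaHat ω x ≠ 0 := fun x hx => (hbpos.trans_le (hmaps hx).1).ne'
  have hint : IntervalIntegrable (fun r => ω r * omegaHat ω r ^ (α - 1)) volume a b := by
    refine (hω.intervalIntegrable ha (hab.trans hb.le) (ha.trans hab) hb.le).mul_continuousOn ?_
    exact hcont.rpow_const fun x hx => Or.inl (hne x hx)
  refine ⟨hint, ?_⟩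
  obtain ⟨L, hL⟩ : ∃ L, LipschitzOnWith L (fun y : ℝ => y ^ α)
      (Icc (omegaHat ω b) (omegaHat ω a)) := by
    have hC : ContDiffOn ℝ 1 (fun y : ℝ => y ^ α) (Icc (omegaHat ω b) (omegaHat ω a)) :=
      fun y hy => (Real.contDiffAt_rpow_const_of_ne (hbpos.trans_le hy.1).ne').contDiffWithinAt
    exact hC.exists_lipschitzOnWith (by decide) (convex_Icc _ _) isCompact_Icc
  have hac := ((omegaHat_absolutelyContinuous hω).mono
    (by rwa [uIcc_of_le (zero_le_one (α := ℝ))])).lipschitzOnWith_comp hL hmaps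
  have hftc := hac.integral_deriv_eq_sub
  have hcongr : ∫ x in a..b, deriv ((fun y : ℝ => y ^ α) ∘ omegaHat ω) x =
      ∫ x in a..b, (-α) * (ω x * omegaHat ω x ^ (α - 1)) := by
    refine intervalIntegral.integral_congr_ae ?_
    filter_upwards [omegaHat_ae_hasDerivAt hω] with x hx hxab
    have hx' := uIoc_subset_uIcc hxab
    have h := (hx (hsub hx')).rpow_const (p := α) (Or.inl (hne x hx'))
    have := h.deriv
    rw [Function.comp_def, this]; ring
  rw [hcongr, intervalIntegral.integral_const_mul] at hftc
  simp only [Function.comp] at hftc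
  field_simp
  linarith

theorem weight_rpow_tail (hω : IsRadialWeight ω)
    (hpos : ∀ r ∈ Set.Ico (0:ℝ) 1, 0 < omegaHat ω r) {α : ℝ} (hα : 0 < α) :
    IntervalIntegrable (fun r => ω r * omegaHat ω r ^ (α - 1)) volume 0 1 ∧
      ∀ a ∈ Ico (0 : ℝ) 1,
        ∫ r in a..1, ω r * omegaHat ω r ^ (α - 1) = omegaHat ω a ^ α / α := by
  set μ : ℝ → ℝ := fun r => ω r * omegaHat ω r ^ (α - 1) with hμ
  have hμ0 : ∀ r ∈ Ico (0:ℝ) 1, 0 ≤ μ r := fun r hr =>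
    mul_nonneg (hω.1 r hr) (Real.rpow_nonneg (hpos r hr).le _)
  have h01 : IntervalIntegrable μ volume 0 1 := by
    rw [intervalIntegrable_iff_integrableOn_Ioc_of_le zero_le_one]
    have hlim : Tendsto (fun n : ℕ => 1 - 1 / ((n : ℝ) + 1)) atTop (nhds 1) := by
      simpa using tendsto_one_div_add_atTop_nhds_zero_nat.const_sub (1 : ℝ)
    have hb : ∀ n : ℕ, 0 ≤ 1 - 1 / ((n : ℝ) + 1) ∧ 1 - 1 / ((n : ℝ) + 1) < 1 := by
      intro n
      have : (0:ℝ) < 1 / ((n : ℝ) + 1) := by positivity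
      have : 1 / ((n : ℝ) + 1) ≤ 1 := by
        rw [div_le_one (by positivity)]; linarith [(n.cast_nonneg : (0:ℝ) ≤ n)]
      constructor <;> linarith
    refine integrableOn_Ioc_of_intervalIntegral_norm_bounded_right
      (I := omegaHat ω 0 ^ α / α) (fun n => ?_) hlim (Eventually.of_forall fun n => ?_)
    · have := (integral_weight_rpow hω hpos hα le_rfl (hb n).1 (hb n).2).1
      rwa [intervalIntegrable_iff_integrableOn_Ioc_of_le (hb n).1] at this
    · have h := (integral_weight_rpow hω hpos hα le_rfl (hb n).1 (hb n).2).2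
      rw [intervalIntegral.integral_of_le (hb n).1] at h
      have e : ∫ x in Ioc 0 (1 - 1 / ((n : ℝ) + 1)), ‖μ x‖ =
          ∫ x in Ioc 0 (1 - 1 / ((n : ℝ) + 1)), μ x := by
        refine setIntegral_congr_fun measurableSet_Ioc fun x hx => ?_
        exact Real.norm_of_nonneg (hμ0 x ⟨hx.1.le, hx.2.trans_lt (hb n).2⟩)
      rw [e, h]
      have := Real.rpow_nonneg (hpos _ ⟨(hb n).1, (hb n).2⟩).le α
      gcongr
      linarith
  refine ⟨h01, fun a ha => ?_⟩
  have ha1 : IntervalIntegrable μ volume a 1 := h01.mono_set (by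
    rw [uIcc_of_le zero_le_one, uIcc_of_le ha.2.le]; exact Icc_subset_Icc_left ha.1)
  have hc1 : ContinuousOn (fun b => ∫ r in a..b, μ r) (Icc a 1) := by
    have := intervalIntegral.continuousOn_primitive_interval' ha1 left_mem_uIcc
    rwa [uIcc_of_le ha.2.le] at this
  have hc2 : ContinuousOn (fun b => (omegaHat ω a ^ α - omegaHat ω b ^ α) / α) (Icc a 1) := by
    refine ContinuousOn.div_const (continuousOn_const.sub ?_) _
    exact ((omegaHat_continuousOn hω).mono (Icc_subset_Icc_left ha.1)).rpow_const
      fun _ _ => Or.inr hα.le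
  have hd : EqOn (fun b => ∫ r in a..b, μ r)
      (fun b => (omegaHat ω a ^ α - omegaHat ω b ^ α) / α) (Icc a 1) := by
    have hE : EqOn (fun b => ∫ r in a..b, μ r)
        (fun b => (omegaHat ω a ^ α - omegaHat ω b ^ α) / α) (Ico a 1) :=
      fun b hb => (integral_weight_rpow hω hpos hα ha.1 hb.1 hb.2).2
    refine hE.of_subset_closure hc1 hc2 Ico_subset_Icc_self ?_
    rw [closure_Ico ha.2.ne]
  have h1 := hd (right_mem_Icc.2 ha.2.le)
  simp only at h1
  rw [h1, omegaHat]
  simp [Real.zero_rpow hα.ne', omegaHat]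

end RadialWeight
section Moments

variable {μ : ℝ → ℝ}

theorem moment_integrable (hint : IntervalIntegrable μ volume 0 1) {x : ℝ} (hx : 0 ≤ x)
    {a b : ℝ} (ha : 0 ≤ a) (ha1 : a ≤ 1) (hb : 0 ≤ b) (hb1 : b ≤ 1) :
    IntervalIntegrable (fun r => r ^ x * μ r) volume a b := by
  have h : IntervalIntegrable (fun r => r ^ x * μ r) volume 0 1 :=
    hint.continuousOn_mul (continuousOn_id.rpow_const fun _ _ => Or.inr hx)
  exact h.mono_set (by
    rw [uIcc_of_le zero_le_one]
    exact uIcc_subset_Icc ⟨ha, ha1⟩ ⟨hb, hb1⟩)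

theorem integral_mono_Ico {f g : ℝ → ℝ} {a b : ℝ} (hab : a ≤ b)
    (hf : IntervalIntegrable f volume a b) (hg : IntervalIntegrable g volume a b)
    (h : ∀ r ∈ Ico a b, f r ≤ g r) : ∫ r in a..b, f r ≤ ∫ r in a..b, g r := by
  refine intervalIntegral.integral_mono_on_of_le_Ioo hab hf hg fun r hr => h r ⟨hr.1.le, hr.2⟩

theorem momentW_anti (hμ : ∀ r ∈ Ico (0:ℝ) 1, 0 ≤ μ r) (hint : IntervalIntegrable μ volume 0 1)
    {x y : ℝ} (hx : 0 < x) (hxy : x ≤ y) : momentW μ y ≤ momentW μ x := by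
  refine integral_mono_Ico zero_le_one
    (moment_integrable hint (hx.le.trans hxy) le_rfl zero_le_one zero_le_one le_rfl)
    (moment_integrable hint hx.le le_rfl zero_le_one zero_le_one le_rfl) fun r hr => ?_
  exact mul_le_mul_of_nonneg_right
    (Real.rpow_le_rpow_of_exponent_ge_of_imp hr.1 hr.2.le hxy (fun _ h => absurd h (hx.trans_le hxy).ne'))
    (hμ r hr)

theorem momentW_split (hint : IntervalIntegrable μ volume 0 1) {x : ℝ} (hx : 0 ≤ x) {ρ : ℝ}
    (hρ : ρ ∈ Icc (0:ℝ) 1) :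
    momentW μ x = (∫ r in (0:ℝ)..ρ, r ^ x * μ r) + ∫ r in ρ..1, r ^ x * μ r :=
  (intervalIntegral.integral_add_adjacent_intervals
    (moment_integrable hint hx le_rfl zero_le_one hρ.1 hρ.2)
    (moment_integrable hint hx hρ.1 hρ.2 zero_le_one le_rfl)).symm

theorem rpow_mul_tail_le_momentW (hμ : ∀ r ∈ Ico (0:ℝ) 1, 0 ≤ μ r)
    (hint : IntervalIntegrable μ volume 0 1) {x : ℝ} (hx : 0 ≤ x) {ρ : ℝ}
    (hρ : ρ ∈ Ico (0:ℝ) 1) : ρ ^ x * omegaHat μ ρ ≤ momentW μ x := by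
  rw [momentW_split hint hx ⟨hρ.1, hρ.2.le⟩, omegaHat, ← intervalIntegral.integral_const_mul]
  have h1 : 0 ≤ ∫ r in (0:ℝ)..ρ, r ^ x * μ r := by
    refine intervalIntegral.integral_nonneg hρ.1 fun r hr => ?_
    exact mul_nonneg (Real.rpow_nonneg hr.1 _) (hμ r ⟨hr.1, hr.2.trans_lt hρ.2⟩)
  have h2 : ∫ r in ρ..1, ρ ^ x * μ r ≤ ∫ r in ρ..1, r ^ x * μ r := by
    refine integral_mono_Ico hρ.2.le (IntervalIntegrable.const_mul (hint.mono_set ?_) _)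
      (moment_integrable hint hx hρ.1 hρ.2.le zero_le_one le_rfl) fun r hr => ?_
    · rw [uIcc_of_le zero_le_one, uIcc_of_le hρ.2.le]; exact Icc_subset_Icc_left hρ.1
    · exact mul_le_mul_of_nonneg_right (Real.rpow_le_rpow hρ.1 hr.1 hx)
        (hμ r ⟨hρ.1.trans hr.1, hr.2⟩)
  linarith

theorem tail_le_momentW (hμ : ∀ r ∈ Ico (0:ℝ) 1, 0 ≤ μ r)
    (hint : IntervalIntegrable μ volume 0 1) {x : ℝ} (hx : 2 ≤ x) :
    omegaHat μ (1 - 1 / x) ≤ 4 * momentW μ x := by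
  have hx0 : 0 < x := by linarith
  have hinv : 1 / x ≤ 1 / 2 := one_div_le_one_div_of_le two_pos hx
  have hinv0 : 0 < 1 / x := by positivity
  have hρ : 1 - 1 / x ∈ Ico (0:ℝ) 1 := ⟨by linarith, by linarith⟩
  have h := rpow_mul_tail_le_momentW hμ hint hx0.le hρ
  have hT : 0 ≤ omegaHat μ (1 - 1 / x) := by
    have := intervalIntegral.integral_mono_on_of_le_Ioo hρ.2.le
      (intervalIntegrable_const (c := (0:ℝ))) (hint.mono_set (by
        rw [uIcc_of_le zero_le_one, uIcc_of_le hρ.2.le]; exact Icc_subset_Icc_left hρ.1))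
      fun r hr => hμ r ⟨hρ.1.trans hr.1.le, hr.2⟩
    simpa [omegaHat] using this
  have hb : (1 / 2 : ℝ) ≤ (1 - 1 / x) ^ (x / 2) := by
    have := one_add_mul_self_le_rpow_one_add (s := -(1 / x)) (by linarith) (p := x / 2)
      (by linarith)
    have e : 1 + x / 2 * -(1 / x) = 1 / 2 := by field_simp; norm_num
    rwa [e, ← sub_eq_add_neg] at this
  have hq : (1 / 4 : ℝ) ≤ (1 - 1 / x) ^ x := by
    have e : (1 - 1 / x) ^ x = (1 - 1 / x) ^ (x / 2) * (1 - 1 / x) ^ (x / 2) := by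
      rw [← Real.rpow_add_of_nonneg hρ.1 (by linarith) (by linarith)]; ring_nf
    rw [e]; nlinarith
  nlinarith

theorem momentW_le_exp_mul_add_tail (hμ : ∀ r ∈ Ico (0:ℝ) 1, 0 ≤ μ r)
    (hint : IntervalIntegrable μ volume 0 1) {x L : ℝ} (hL : 0 < L) (hLx : L < x) :
    momentW μ x ≤ Real.exp (-(L / 2)) * momentW μ (x / 2) + omegaHat μ (1 - L / x) := by
  have hx0 : 0 < x := hL.trans hLx
  have hq : L / x < 1 := (div_lt_one hx0).2 hLx
  have hq0 : 0 < L / x := by positivity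
  have hρ : 1 - L / x ∈ Ico (0:ℝ) 1 := ⟨by linarith, by linarith⟩
  set ρ := 1 - L / x with hρd
  have hx2 : 0 ≤ x / 2 := by linarith
  have hE : ∀ r ∈ Ico (0:ℝ) ρ, r ^ x ≤ Real.exp (-(L / 2)) * r ^ (x / 2) := by
    intro r hr
    have e : r ^ x = r ^ (x / 2) * r ^ (x / 2) := by
      rw [← Real.rpow_add_of_nonneg hr.1 hx2 hx2]; ring_nf
    rw [e]
    refine mul_le_mul_of_nonneg_right ?_ (Real.rpow_nonneg hr.1 _)
    calc r ^ (x / 2) ≤ Real.exp (-(L / x)) ^ (x / 2) := by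
          refine Real.rpow_le_rpow hr.1 (hr.2.le.trans ?_) hx2
          have := Real.add_one_le_exp (-(L / x))
          rw [hρd]; linarith
      _ = Real.exp (-(L / 2)) := by
          rw [← Real.exp_mul]; congr 1; field_simp
  have h1 : ∫ r in (0:ℝ)..ρ, r ^ x * μ r ≤
      Real.exp (-(L / 2)) * ∫ r in (0:ℝ)..ρ, r ^ (x / 2) * μ r := by
    rw [← intervalIntegral.integral_const_mul]
    refine integral_mono_Ico hρ.1 (moment_integrable hint hx0.le le_rfl zero_le_one hρ.1 hρ.2.le)
      ((moment_integrable hint hx2 le_rfl zero_le_one hρ.1 hρ.2.le).const_mul _) fun r hr => ?_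
    have := mul_le_mul_of_nonneg_right (hE r hr) (hμ r ⟨hr.1, hr.2.trans hρ.2⟩)
    rwa [mul_assoc] at this
  have h2 : ∫ r in ρ..1, r ^ x * μ r ≤ omegaHat μ ρ := by
    refine integral_mono_Ico hρ.2.le
      (moment_integrable hint hx0.le hρ.1 hρ.2.le zero_le_one le_rfl) (hint.mono_set ?_)
      fun r hr => ?_
    · rw [uIcc_of_le zero_le_one, uIcc_of_le hρ.2.le]; exact Icc_subset_Icc_left hρ.1
    · exact mul_le_of_le_one_left (hμ r ⟨hρ.1.trans hr.1, hr.2⟩)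
        (Real.rpow_le_one (hρ.1.trans hr.1) hr.2.le hx0.le)
  have h3 : 0 ≤ ∫ r in ρ..1, r ^ (x / 2) * μ r := by
    have := integral_mono_Ico hρ.2.le (intervalIntegrable_const (c := (0:ℝ)))
      (moment_integrable hint hx2 hρ.1 hρ.2.le zero_le_one le_rfl)
      fun r hr => mul_nonneg (Real.rpow_nonneg (hρ.1.trans hr.1) _)
        (hμ r ⟨hρ.1.trans hr.1, hr.2⟩)
    simpa using this
  rw [momentW_split hint hx0.le ⟨hρ.1, hρ.2.le⟩, momentW_split hint hx2 ⟨hρ.1, hρ.2.le⟩, mul_add]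
  have := mul_nonneg (Real.exp_pos (-(L / 2))).le h3
  linarith

theorem momentW_le_tail_zero (hμ : ∀ r ∈ Ico (0:ℝ) 1, 0 ≤ μ r)
    (hint : IntervalIntegrable μ volume 0 1) {x : ℝ} (hx : 0 ≤ x) :
    momentW μ x ≤ omegaHat μ 0 := by
  refine integral_mono_Ico zero_le_one
    (moment_integrable hint hx le_rfl zero_le_one zero_le_one le_rfl) hint fun r hr => ?_
  exact mul_le_of_le_one_left (hμ r hr) (Real.rpow_le_one hr.1 hr.2.le hx)

/-- In the class `D̂` the tail does not shrink by more than a constant when the distance to the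
boundary is halved, also past the origin. -/
theorem tail_doubling {C : ℝ} (hw : IsRadialWeight μ) (hC : 1 ≤ C)
    (h0 : ∀ r ∈ Ico (0:ℝ) 1, 0 ≤ omegaHat μ r)
    (hD : ∀ r ∈ Ico (0:ℝ) 1, omegaHat μ r ≤ C * omegaHat μ ((1 + r) / 2)) {t : ℝ} (ht : 0 < t) :
    omegaHat μ (max 0 (1 - 2 * t)) ≤ C * omegaHat μ (max 0 (1 - t)) := by
  rcases le_or_gt 1 t with h | h
  · rw [max_eq_left (by linarith), max_eq_left (by linarith)]
    have := h0 0 ⟨le_rfl, one_pos⟩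
    nlinarith
  · rw [max_eq_right (by linarith : 0 ≤ 1 - t)]
    have hr : max 0 (1 - 2 * t) ∈ Ico (0:ℝ) 1 :=
      ⟨le_max_left _ _, max_lt one_pos (by linarith)⟩
    refine (hD _ hr).trans (mul_le_mul_of_nonneg_left ?_ (by linarith))
    have := le_max_right 0 (1 - 2 * t)
    exact omegaHat_anti hw (by linarith) (by linarith) (by linarith [hr.2])

theorem tail_doubling_iterate {C : ℝ} (hw : IsRadialWeight μ) (hC : 1 ≤ C)
    (h0 : ∀ r ∈ Ico (0:ℝ) 1, 0 ≤ omegaHat μ r)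
    (hD : ∀ r ∈ Ico (0:ℝ) 1, omegaHat μ r ≤ C * omegaHat μ ((1 + r) / 2)) {t : ℝ} (ht : 0 < t)
    (l : ℕ) :
    omegaHat μ (max 0 (1 - 2 ^ l * t)) ≤ C ^ l * omegaHat μ (max 0 (1 - t)) := by
  induction l with
  | zero => simp
  | succ l ih =>
    have h := tail_doubling hw hC h0 hD (t := 2 ^ l * t) (by positivity)
    rw [pow_succ', mul_assoc]
    refine h.trans ?_
    rw [pow_succ', mul_assoc]
    exact mul_le_mul_of_nonneg_left ih (by linarith)

theorem momentW_le_tail {C : ℝ} (hw : IsRadialWeight μ) (hint : IntervalIntegrable μ volume 0 1)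
    (hC : 1 ≤ C) (h0 : ∀ r ∈ Ico (0:ℝ) 1, 0 ≤ omegaHat μ r)
    (hD : ∀ r ∈ Ico (0:ℝ) 1, omegaHat μ r ≤ C * omegaHat μ ((1 + r) / 2)) :
    ∃ B > 0, ∀ x : ℝ, 1 ≤ x → momentW μ x ≤ B * omegaHat μ (1 - 1 / x) := by
  obtain ⟨l, hl⟩ : ∃ l : ℕ, C * Real.exp (-((2:ℝ) ^ l / 2)) ≤ 1 / 2 := by
    obtain ⟨l, hl⟩ := pow_unbounded_of_one_lt (4 * C) (one_lt_two (α := ℝ))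
    refine ⟨l, ?_⟩
    have h1 := Real.add_one_le_exp ((2:ℝ) ^ l / 2)
    rw [Real.exp_neg, ← div_eq_mul_inv, div_le_iff₀ (Real.exp_pos _)]
    linarith
  set L : ℝ := 2 ^ l with hLd
  have hL : 0 < L := by positivity
  have key : ∀ n : ℕ, ∀ x : ℝ, 0 < x → x ≤ 2 ^ n * L →
      momentW μ x ≤ 2 * omegaHat μ (max 0 (1 - L / x)) := by
    have small : ∀ x : ℝ, 0 < x → x ≤ L →
        momentW μ x ≤ 2 * omegaHat μ (max 0 (1 - L / x)) := by
      intro x hx hxL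
      have : 1 ≤ L / x := (one_le_div hx).2 hxL
      rw [max_eq_left (by linarith)]
      have := momentW_le_tail_zero hw.1 hint hx.le
      have := h0 0 ⟨le_rfl, one_pos⟩
      linarith
    intro n
    induction n with
    | zero => intro x hx hxL; exact small x hx (by simpa using hxL)
    | succ n ih =>
      intro x hx hxL
      rcases le_or_gt x L with h | h
      · exact small x hx h
      have hq : L / x < 1 := (div_lt_one hx).2 h
      have i1 := ih (x / 2) (by linarith) (by rw [pow_succ] at hxL; linarith)
      have i2 := momentW_le_exp_mul_add_tail hw.1 hint hL h
      have i3 := tail_doubling hw hC h0 hD (t := L / x) (by positivity)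
      have e : L / (x / 2) = 2 * (L / x) := by field_simp
      rw [e] at i1
      have hmax : max 0 (1 - L / x) = 1 - L / x := max_eq_right (by linarith)
      rw [hmax] at i3 ⊢
      have hT : 0 ≤ omegaHat μ (1 - L / x) := h0 _ ⟨by linarith, by
        have : 0 < L / x := by positivity
        linarith⟩
      have hexp := (Real.exp_pos (-(L / 2))).le
      have i4 := mul_le_mul_of_nonneg_left (i1.trans (mul_le_mul_of_nonneg_left i3 two_pos.le)) hexp
      have i5 := mul_le_mul_of_nonneg_right hl hT
      nlinarith
  refine ⟨2 * C ^ l, by positivity, fun x hx => ?_⟩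
  have hx0 : 0 < x := by linarith
  obtain ⟨n, hn⟩ := pow_unbounded_of_one_lt (x / L) (one_lt_two (α := ℝ))
  rw [div_lt_iff₀ hL] at hn
  refine (key n x hx0 hn.le).trans ?_
  have := tail_doubling_iterate hw hC h0 hD (t := 1 / x) (by positivity) l
  rw [mul_one_div, max_eq_right (a := 0) (b := 1 - 1 / x)
    (by rw [sub_nonneg, div_le_one hx0]; exact hx)] at this
  rw [mul_assoc]
  exact mul_le_mul_of_nonneg_left this two_pos.le

theorem tail_le_momentW_of_doubling {C : ℝ} (hw : IsRadialWeight μ)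
    (hint : IntervalIntegrable μ volume 0 1) (hC : 1 ≤ C)
    (h0 : ∀ r ∈ Ico (0:ℝ) 1, 0 ≤ omegaHat μ r)
    (hD : ∀ r ∈ Ico (0:ℝ) 1, omegaHat μ r ≤ C * omegaHat μ ((1 + r) / 2)) {x : ℝ} (hx : 1 ≤ x) :
    omegaHat μ (1 - 1 / x) ≤ C ^ 2 * 4 * momentW μ (4 * x) := by
  have hx0 : 0 < x := by linarith
  have hx1 : 1 / x ≤ 1 := (div_le_one hx0).2 hx
  have e : (2:ℝ) ^ 2 * (1 / (4 * x)) = 1 / x := by field_simp; norm_num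
  have h := tail_doubling_iterate hw hC h0 hD (t := 1 / (4 * x)) (by positivity) 2
  have hlt : 1 / (4 * x) ≤ 1 := by rw [div_le_one (by positivity)]; linarith
  rw [e, max_eq_right (by linarith), max_eq_right (by linarith)] at h
  have h2 := tail_le_momentW hw.1 hint (x := 4 * x) (by linarith)
  refine h.trans ?_
  rw [mul_assoc]
  exact mul_le_mul_of_nonneg_left h2 (by positivity)

theorem momentW_doubling {C : ℝ} (hw : IsRadialWeight μ)
    (hint : IntervalIntegrable μ volume 0 1) (hC : 1 ≤ C)
    (h0 : ∀ r ∈ Ico (0:ℝ) 1, 0 ≤ omegaHat μ r)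
    (hD : ∀ r ∈ Ico (0:ℝ) 1, omegaHat μ r ≤ C * omegaHat μ ((1 + r) / 2)) :
    ∃ A > 0, ∀ x : ℝ, 1 ≤ x → momentW μ x ≤ A * momentW μ (4 * x) := by
  obtain ⟨B, hB, h⟩ := momentW_le_tail hw hint hC h0 hD
  refine ⟨B * (C ^ 2 * 4), by positivity, fun x hx => (h x hx).trans ?_⟩
  rw [mul_assoc]
  exact mul_le_mul_of_nonneg_left (tail_le_momentW_of_doubling hw hint hC h0 hD hx) hB.le

/-- The odd moments form a convex sequence. -/
theorem momentCoeff_convex (hw : IsRadialWeight μ) (hint : IntervalIntegrable μ volume 0 1)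
    (k : ℕ) : 0 ≤ momentCoeff μ k - 2 * momentCoeff μ (k + 1) + momentCoeff μ (k + 2) := by
  have hi : ∀ k : ℕ, IntervalIntegrable (fun r => r ^ (2 * (k:ℝ) + 1) * μ r) volume 0 1 :=
    fun k => moment_integrable hint (by positivity) le_rfl zero_le_one zero_le_one le_rfl
  have e : momentCoeff μ k - 2 * momentCoeff μ (k + 1) + momentCoeff μ (k + 2) =
      ∫ r in (0:ℝ)..1, (r ^ (2 * (k:ℝ) + 1) * μ r -
        2 * (r ^ (2 * ((k + 1 : ℕ):ℝ) + 1) * μ r) + r ^ (2 * ((k + 2 : ℕ):ℝ) + 1) * μ r) := by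
    rw [intervalIntegral.integral_add ((hi k).sub ((hi (k + 1)).const_mul 2)) (hi (k + 2)),
      intervalIntegral.integral_sub (hi k) ((hi (k + 1)).const_mul 2),
      intervalIntegral.integral_const_mul]
    rfl
  rw [e]
  have hc : ∀ (r : ℝ) (j : ℕ), r ^ (2 * (j:ℝ) + 1) = r ^ (2 * j + 1) := fun r j => by
    rw [← Real.rpow_natCast]; push_cast; rfl
  have := integral_mono_Ico zero_le_one (intervalIntegrable_const (c := (0:ℝ)))
    (((hi k).sub ((hi (k + 1)).const_mul 2)).add (hi (k + 2))) fun r hr => by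
      have h1 : r ^ (2 * (k:ℝ) + 1) * μ r - 2 * (r ^ (2 * ((k + 1 : ℕ):ℝ) + 1) * μ r) +
          r ^ (2 * ((k + 2 : ℕ):ℝ) + 1) * μ r =
          r ^ (2 * k + 1) * (1 - r ^ 2) ^ 2 * μ r := by
        rw [hc, hc, hc]; ring
      show (0:ℝ) ≤ r ^ (2 * (k:ℝ) + 1) * μ r - 2 * (r ^ (2 * ((k + 1 : ℕ):ℝ) + 1) * μ r) +
          r ^ (2 * ((k + 2 : ℕ):ℝ) + 1) * μ r
      rw [h1]
      exact mul_nonneg (mul_nonneg (pow_nonneg hr.1 _) (sq_nonneg _)) (hw.1 r hr)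
  simpa using this

end Moments

theorem mul_sub_le_of_convex {u : ℕ → ℝ} (h0 : ∀ k, 0 ≤ u k)
    (h2 : ∀ k, 0 ≤ u k - 2 * u (k + 1) + u (k + 2)) (k : ℕ) :
    ((k : ℝ) + 1) * (u k - u (k + 1)) ≤ 2 * u (k / 2) := by
  have hanti : Antitone fun k => u k - u (k + 1) :=
    antitone_nat_of_succ_le fun k => by linarith [h2 k]
  have htel : ∑ i ∈ Finset.Ico (k / 2) (k + 1), (u i - u (i + 1)) = u (k / 2) - u (k + 1) := by
    have := Finset.sum_Ico_sub (fun i => -u i) (show k / 2 ≤ k + 1 by omega)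
    rw [Finset.sum_congr rfl fun i _ => show u i - u (i + 1) = -u (i + 1) - -u i by ring, this]
    ring
  have hle : ((Finset.Ico (k / 2) (k + 1)).card : ℝ) * (u k - u (k + 1)) ≤
      u (k / 2) - u (k + 1) := by
    rw [← htel, ← nsmul_eq_mul]
    refine Finset.card_nsmul_le_sum _ _ _ fun i hi => ?_
    rw [Finset.mem_Ico] at hi
    exact hanti (by omega)
  rw [Nat.card_Ico] at hle
  rcases le_or_gt (u k - u (k + 1)) 0 with h | h
  · have : ((k : ℝ) + 1) * (u k - u (k + 1)) ≤ 0 :=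
      mul_nonpos_of_nonneg_of_nonpos (by positivity) h
    linarith [h0 (k / 2)]
  · have hc : ((k : ℝ) + 1) ≤ 2 * ((k + 1 - k / 2 : ℕ) : ℝ) := by
      have : k + 1 ≤ 2 * (k + 1 - k / 2) := by omega
      exact_mod_cast this
    have := mul_le_mul_of_nonneg_right hc h.le
    linarith [h0 (k + 1)]
namespace AdmissibleSpace

variable (X : AdmissibleSpace)

theorem nrm_zero : X.nrm 0 = 0 := by
  have h := X.nrm_smul 0 0 X.zero_mem
  simpa using h

theorem sum_mem {ι : Type*} (s : Finset ι) (F : ι → ℂ → ℂ) (hF : ∀ i ∈ s, F i ∈ X.carrier) :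
    (∑ i ∈ s, F i) ∈ X.carrier := by
  classical
  induction s using Finset.induction_on with
  | empty => simpa using X.zero_mem
  | insert a s ha ih =>
    rw [Finset.sum_insert ha]
    exact X.add_mem _ _ (hF _ (Finset.mem_insert_self _ _))
      (ih fun i hi => hF i (Finset.mem_insert_of_mem hi))

theorem nrm_sum_le {ι : Type*} (s : Finset ι) (F : ι → ℂ → ℂ) (hF : ∀ i ∈ s, F i ∈ X.carrier) :
    X.nrm (∑ i ∈ s, F i) ≤ ∑ i ∈ s, X.nrm (F i) := by
  classical
  induction s using Finset.induction_on with
  | empty => simp [X.nrm_zero]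
  | insert a s ha ih =>
    rw [Finset.sum_insert ha, Finset.sum_insert ha]
    have hs : ∀ i ∈ s, F i ∈ X.carrier := fun i hi => hF i (Finset.mem_insert_of_mem hi)
    refine (X.nrm_add _ _ (hF _ (Finset.mem_insert_self _ _)) (X.sum_mem s F hs)).trans ?_
    have := ih hs
    linarith

theorem polynomial_sum_mem (hpoly : ∀ Q : Polynomial ℂ, (fun z => Q.eval z) ∈ X.carrier)
    (b : ℕ → ℂ) (R : ℕ) : (fun z => ∑ j ∈ Finset.range R, b j * z ^ j) ∈ X.carrier := by
  have h := hpoly (∑ j ∈ Finset.range R, Polynomial.C (b j) * Polynomial.X ^ j)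
  simpa [Polynomial.eval_finsetSum] using h

end AdmissibleSpace

/-- The Fourier coefficients of the discrete Fejér kernel on the `L`-th roots of unity. -/
theorem fejer_coeff {L : ℕ} {ζ : ℂ} (hζ : IsPrimitiveRoot ζ L) (k i : ℕ) (h : i + k < L) :
    ∑ l ∈ Finset.range L,
      (((‖∑ a ∈ Finset.range (k + 1), (ζ ^ l) ^ a‖ ^ 2 : ℝ) : ℂ)) * (ζ ^ l) ^ i =
      (L : ℂ) * ((k + 1 - i : ℕ) : ℂ) := by
  have hL : L ≠ 0 := by omega
  have hn : ‖ζ‖ = 1 := hζ.norm'_eq_one hL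
  have hconj : ζ * (starRingEnd ℂ) ζ = 1 := by
    rw [Complex.mul_conj, Complex.normSq_eq_norm_sq, hn]; simp
  have key : ∀ a ∈ Finset.range (k + 1), ∀ b ∈ Finset.range (k + 1),
      ∑ l ∈ Finset.range L, (ζ ^ (a + i) * (starRingEnd ℂ) ζ ^ b) ^ l =
        if a + i = b then (L : ℂ) else 0 := by
    intro a ha b hb
    rw [Finset.mem_range] at ha hb
    set w := ζ ^ (a + i) * (starRingEnd ℂ) ζ ^ b with hw
    have hwb : w * ζ ^ b = ζ ^ (a + i) := by
      rw [hw, mul_assoc, ← mul_pow, mul_comm _ ζ, hconj, one_pow, mul_one]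
    have hwL : w ^ L = 1 := by
      have h1 : ζ ^ L = 1 := hζ.pow_eq_one
      rw [hw, mul_pow, ← pow_mul, ← pow_mul, mul_comm (a + i), mul_comm b, pow_mul, pow_mul,
        ← map_pow, h1]
      simp
    split_ifs with hab
    · have : w = 1 := by
        have h0 : ζ ^ b ≠ 0 := pow_ne_zero _ (hζ.ne_zero hL)
        apply mul_right_cancel₀ h0
        rw [hwb, hab, one_mul]
      simp [this]
    · have hw1 : w ≠ 1 := by
        intro hw1
        rw [hw1, one_mul] at hwb
        exact hab (hζ.pow_inj (by omega) (by omega) hwb.symm)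
      rw [geom_sum_eq hw1, hwL]
      simp
  have hsq : ∀ l, (((‖∑ a ∈ Finset.range (k + 1), (ζ ^ l) ^ a‖ ^ 2 : ℝ) : ℂ)) * (ζ ^ l) ^ i =
      ∑ a ∈ Finset.range (k + 1), ∑ b ∈ Finset.range (k + 1),
        (ζ ^ (a + i) * (starRingEnd ℂ) ζ ^ b) ^ l := by
    intro l
    rw [← Complex.normSq_eq_norm_sq, ← Complex.mul_conj, map_sum, Finset.sum_mul_sum,
      Finset.sum_mul]
    refine Finset.sum_congr rfl fun a _ => ?_
    rw [Finset.sum_mul]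
    refine Finset.sum_congr rfl fun b _ => ?_
    simp only [map_pow]
    ring
  simp_rw [hsq]
  rw [Finset.sum_comm]
  simp_rw [Finset.sum_comm (s := Finset.range L)]
  rw [Finset.sum_congr rfl fun a ha => Finset.sum_congr rfl fun b hb => key a ha b hb]
  have hin : ∀ a ∈ Finset.range (k + 1), (∑ b ∈ Finset.range (k + 1),
      if a + i = b then (L : ℂ) else 0) = if a < k + 1 - i then (L : ℂ) else 0 := by
    intro a _
    rw [Finset.sum_ite_eq]
    simp only [Finset.mem_range]
    congr 1
    simp only [eq_iff_iff]; omega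
  rw [Finset.sum_congr rfl hin, ← Finset.sum_filter]
  have : (Finset.range (k + 1)).filter (fun a => a < k + 1 - i) = Finset.range (k + 1 - i) := by
    ext a; simp only [Finset.mem_filter, Finset.mem_range]; omega
  rw [this]; simp [mul_comm]

/-- Shifted Fejér means are bounded on admissible spaces. -/
theorem AdmissibleSpace.nrm_fejer_le (X : AdmissibleSpace)
    (hpoly : ∀ Q : Polynomial ℂ, (fun z => Q.eval z) ∈ X.carrier) {A : ℝ}
    (hA : ∀ f ∈ X.carrier, ∀ ζ : ℂ, ‖ζ‖ ≤ 1 → X.nrm (fun z => f (ζ * z)) ≤ A * X.nrm f)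
    (hmem : ∀ f ∈ X.carrier, ∀ ζ : ℂ, ‖ζ‖ ≤ 1 → (fun z => f (ζ * z)) ∈ X.carrier)
    (b : ℕ → ℂ) (R m k : ℕ) (hb : ∀ j, b j ≠ 0 → m ≤ j) :
    X.nrm (fun z => ∑ j ∈ Finset.range R, ((k + 1 - (j - m) : ℕ) : ℂ) * b j * z ^ j) ≤
      A * (k + 1) * X.nrm (fun z => ∑ j ∈ Finset.range R, b j * z ^ j) := by
  set f : ℂ → ℂ := fun z => ∑ j ∈ Finset.range R, b j * z ^ j with hf
  have hfX : f ∈ X.carrier := X.polynomial_sum_mem hpoly b R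
  obtain ⟨L, hLR, hL0⟩ : ∃ L : ℕ, R + k < L ∧ L ≠ 0 := ⟨R + k + 1, by omega, by omega⟩
  set ζ : ℂ := Complex.exp (2 * Real.pi * Complex.I / L) with hζdef
  have hζ : IsPrimitiveRoot ζ L := Complex.isPrimitiveRoot_exp L hL0
  have hn : ‖ζ‖ = 1 := hζ.norm'_eq_one hL0
  have hconj : (starRingEnd ℂ) ζ * ζ = 1 := by
    rw [mul_comm, Complex.mul_conj, Complex.normSq_eq_norm_sq, hn]; simp
  have hLC : (L : ℂ) ≠ 0 := by exact_mod_cast hL0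
  have hLR' : (L : ℝ) ≠ 0 := by exact_mod_cast hL0
  set S : ℕ → ℝ := fun l => ‖∑ a ∈ Finset.range (k + 1), (ζ ^ l) ^ a‖ ^ 2 with hS
  have hS0 : ∀ l, 0 ≤ S l := fun l => by positivity
  let F : ℕ → ℂ → ℂ := fun l =>
    ((L : ℂ)⁻¹ * ((S l : ℝ) : ℂ) * ((starRingEnd ℂ) ζ ^ l) ^ m) • fun z => f (ζ ^ l * z)
  have hzl : ∀ l : ℕ, ‖ζ ^ l‖ ≤ 1 := fun l => by simp [hn]
  have heq : (fun z => ∑ j ∈ Finset.range R, ((k + 1 - (j - m) : ℕ) : ℂ) * b j * z ^ j) =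
      ∑ l ∈ Finset.range L, F l := by
    funext z
    simp only [Finset.sum_apply, F, Pi.smul_apply, smul_eq_mul, hf, Finset.mul_sum]
    rw [Finset.sum_comm]
    refine Finset.sum_congr rfl fun j hj => ?_
    by_cases hbj : b j = 0
    · simp [hbj]
    have hmj := hb j hbj
    rw [Finset.mem_range] at hj
    have hc := fejer_coeff hζ k (j - m) (by omega)
    have : ∀ l : ℕ, (L : ℂ)⁻¹ * ((S l : ℝ) : ℂ) * ((starRingEnd ℂ) ζ ^ l) ^ m *
        (b j * (ζ ^ l * z) ^ j) =
        (L : ℂ)⁻¹ * b j * z ^ j * (((S l : ℝ) : ℂ) * (ζ ^ l) ^ (j - m)) := by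
      intro l
      have h1 : ((starRingEnd ℂ) ζ ^ l) ^ m * (ζ ^ l) ^ j = (ζ ^ l) ^ (j - m) := by
        conv_lhs => rw [show j = m + (j - m) by omega, pow_add, ← mul_assoc, ← mul_pow,
          ← mul_pow, hconj]
        simp
      rw [← h1]; ring
    simp_rw [this]
    rw [← Finset.mul_sum, hc]
    field_simp
  have hmass : ∑ l ∈ Finset.range L, S l = L * (k + 1) := by
    have hc := fejer_coeff hζ k 0 (by omega)
    have h2 : ((∑ l ∈ Finset.range L, S l : ℝ) : ℂ) = ((L * (k + 1) : ℝ) : ℂ) := by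
      push_cast
      simpa [hS] using hc
    exact_mod_cast h2
  rw [heq]
  refine (X.nrm_sum_le _ _ fun l _ => X.smul_mem _ _ (hmem f hfX _ (hzl l))).trans ?_
  have hF : ∀ l ∈ Finset.range L, X.nrm (F l) ≤ (L : ℝ)⁻¹ * A * X.nrm f * S l := by
    intro l _
    rw [X.nrm_smul _ _ (hmem f hfX _ (hzl l))]
    have h1 : ‖(L : ℂ)⁻¹ * ((S l : ℝ) : ℂ) * ((starRingEnd ℂ) ζ ^ l) ^ m‖ = (L : ℝ)⁻¹ * S l := by
      simp [hn, abs_of_nonneg (hS0 l)]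
    rw [h1]
    calc _ ≤ (L : ℝ)⁻¹ * S l * (A * X.nrm f) :=
          mul_le_mul_of_nonneg_left (hA f hfX _ (hzl l)) (mul_nonneg (by positivity) (hS0 l))
      _ = _ := by ring
  refine (Finset.sum_le_sum hF).trans (le_of_eq ?_)
  rw [← Finset.mul_sum, hmass]
  field_simp

/-- Abel summation by parts, twice. -/
theorem second_difference_expansion (v : ℕ → ℝ) (D i : ℕ) (hi : i ≤ D) :
    v i = v (D + 1) + ((D + 1 - i : ℕ) : ℝ) * (v D - v (D + 1)) +
      ∑ k ∈ Finset.range D, ((k + 1 - i : ℕ) : ℝ) * (v k - 2 * v (k + 1) + v (k + 2)) := by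
  induction D with
  | zero => obtain rfl : i = 0 := by omega
            simp
  | succ D ih =>
    rw [Finset.sum_range_succ]
    rcases Nat.lt_or_ge D i with h | h
    · obtain rfl : i = D + 1 := by omega
      have : ∀ k ∈ Finset.range D, ((k + 1 - (D + 1) : ℕ) : ℝ) *
          (v k - 2 * v (k + 1) + v (k + 2)) = 0 := by
        intro k hk
        rw [Finset.mem_range] at hk
        rw [show k + 1 - (D + 1) = 0 by omega]; simp
      rw [Finset.sum_eq_zero this]
      simp
    · have h1 := ih h
      have e1 : ((D + 1 - i : ℕ) : ℝ) = (D : ℝ) + 1 - i := by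
        rw [Nat.cast_sub (by omega)]; push_cast; ring
      have e2 : ((D + 1 + 1 - i : ℕ) : ℝ) = (D : ℝ) + 1 + 1 - i := by
        rw [Nat.cast_sub (by omega)]; push_cast; ring
      rw [e1] at h1
      rw [e1, e2]
      linear_combination h1

/-- A coefficient multiplier whose second differences are summable against `k + 1` is bounded on
polynomials with spectrum in `[m, m + D]`. -/
theorem AdmissibleSpace.nrm_multiplier_le (X : AdmissibleSpace)
    (hpoly : ∀ Q : Polynomial ℂ, (fun z => Q.eval z) ∈ X.carrier) {A : ℝ}
    (hA : ∀ f ∈ X.carrier, ∀ ζ : ℂ, ‖ζ‖ ≤ 1 → X.nrm (fun z => f (ζ * z)) ≤ A * X.nrm f)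
    (hmem : ∀ f ∈ X.carrier, ∀ ζ : ℂ, ‖ζ‖ ≤ 1 → (fun z => f (ζ * z)) ∈ X.carrier)
    (b : ℕ → ℂ) (R m D : ℕ) (hb : ∀ j, b j ≠ 0 → m ≤ j ∧ j ≤ m + D) (v : ℕ → ℝ) :
    X.nrm (fun z => ∑ j ∈ Finset.range R, ((v (j - m) : ℝ) : ℂ) * b j * z ^ j) ≤
      A * (|v (D + 1)| + (D + 1) * |v D - v (D + 1)| +
        ∑ k ∈ Finset.range D, (k + 1) * |v k - 2 * v (k + 1) + v (k + 2)|) *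
      X.nrm (fun z => ∑ j ∈ Finset.range R, b j * z ^ j) := by
  set f : ℂ → ℂ := fun z => ∑ j ∈ Finset.range R, b j * z ^ j with hf
  have hfX : f ∈ X.carrier := X.polynomial_sum_mem hpoly b R
  let G : ℕ → ℂ → ℂ := fun k z =>
    ∑ j ∈ Finset.range R, ((k + 1 - (j - m) : ℕ) : ℂ) * b j * z ^ j
  have hGX : ∀ k, G k ∈ X.carrier := fun k =>
    X.polynomial_sum_mem hpoly (fun j => ((k + 1 - (j - m) : ℕ) : ℂ) * b j) R
  have hG : ∀ k, X.nrm (G k) ≤ A * (k + 1) * X.nrm f := fun k =>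
    X.nrm_fejer_le hpoly hA hmem b R m k fun j hj => (hb j hj).1
  have heq : (fun z => ∑ j ∈ Finset.range R, ((v (j - m) : ℝ) : ℂ) * b j * z ^ j) =
      (((v (D + 1) : ℝ) : ℂ) • f + (((v D - v (D + 1) : ℝ)) : ℂ) • G D) +
        ∑ k ∈ Finset.range D, (((v k - 2 * v (k + 1) + v (k + 2) : ℝ)) : ℂ) • G k := by
    funext z
    simp only [Pi.add_apply, Finset.sum_apply, Pi.smul_apply, smul_eq_mul, hf, G, Finset.mul_sum]
    rw [Finset.sum_comm, ← Finset.sum_add_distrib, ← Finset.sum_add_distrib]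
    refine Finset.sum_congr rfl fun j _ => ?_
    by_cases hbj : b j = 0
    · simp [hbj]
    have hj := hb j hbj
    rw [second_difference_expansion v D (j - m) (by omega)]
    push_cast
    rw [add_mul, add_mul, add_mul, add_mul, Finset.sum_mul, Finset.sum_mul]
    congr 1
    · ring
    · exact Finset.sum_congr rfl fun k _ => by ring
  rw [heq]
  have hf1 : X.nrm f ≤ A * X.nrm f := by simpa using hA f hfX 1 (by simp)
  have m1 := X.smul_mem ((v (D + 1) : ℝ) : ℂ) f hfX
  have m2 := X.smul_mem (((v D - v (D + 1) : ℝ)) : ℂ) (G D) (hGX D)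
  have m3 : ∀ k ∈ Finset.range D,
      ((((v k - 2 * v (k + 1) + v (k + 2) : ℝ)) : ℂ) • G k) ∈ X.carrier :=
    fun k _ => X.smul_mem _ _ (hGX k)
  refine (X.nrm_add _ _ (X.add_mem _ _ m1 m2) (X.sum_mem _ _ m3)).trans ?_
  have h12 := X.nrm_add _ _ m1 m2
  rw [X.nrm_smul _ _ hfX, X.nrm_smul _ _ (hGX D), Complex.norm_real, Complex.norm_real,
    Real.norm_eq_abs, Real.norm_eq_abs] at h12
  have b1 := mul_le_mul_of_nonneg_left hf1 (abs_nonneg (v (D + 1)))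
  have b2 := mul_le_mul_of_nonneg_left (hG D) (abs_nonneg (v D - v (D + 1)))
  have b3 : X.nrm (∑ k ∈ Finset.range D, (((v k - 2 * v (k + 1) + v (k + 2) : ℝ)) : ℂ) • G k) ≤
      A * (∑ k ∈ Finset.range D, (k + 1) * |v k - 2 * v (k + 1) + v (k + 2)|) * X.nrm f := by
    refine (X.nrm_sum_le _ _ m3).trans ?_
    rw [Finset.mul_sum, Finset.sum_mul]
    refine Finset.sum_le_sum fun k _ => ?_
    rw [X.nrm_smul _ _ (hGX k), Complex.norm_real, Real.norm_eq_abs]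
    refine (mul_le_mul_of_nonneg_left (hG k) (abs_nonneg _)).trans (le_of_eq (by ring))
  nlinarith [h12, b1, b2, b3]

/-- Multiplier bound for decreasing convex sequences. -/
theorem convex_multiplier_const (v : ℕ → ℝ) (h0 : ∀ k, 0 ≤ v k) (h1 : ∀ k, v (k + 1) ≤ v k)
    (h2 : ∀ k, 0 ≤ v k - 2 * v (k + 1) + v (k + 2)) (D : ℕ) :
    |v (D + 1)| + (D + 1) * |v D - v (D + 1)| +
        ∑ k ∈ Finset.range D, ((k : ℝ) + 1) * |v k - 2 * v (k + 1) + v (k + 2)| = v 0 := by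
  have h := second_difference_expansion v D 0 (Nat.zero_le _)
  rw [abs_of_nonneg (h0 _), abs_of_nonneg (sub_nonneg.2 (h1 D)), h]
  simp only [Nat.sub_zero, Nat.cast_add, Nat.cast_one]
  congr 1
  exact Finset.sum_congr rfl fun k _ => by rw [abs_of_nonneg (h2 k)]

/-- Multiplier bound for the reciprocals of a doubling decreasing convex sequence. -/
theorem reciprocal_multiplier_const (u : ℕ → ℝ) (h0 : ∀ k, 0 < u k)
    (h1 : ∀ k, u (k + 1) ≤ u k) (h2 : ∀ k, 0 ≤ u k - 2 * u (k + 1) + u (k + 2)) {B : ℝ}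
    (hB : ∀ k : ℕ, ((k : ℝ) + 1) * (u k - u (k + 1)) ≤ B * u (k + 1)) (D : ℕ) :
    |(u (D + 1))⁻¹| + (D + 1) * |(u D)⁻¹ - (u (D + 1))⁻¹| +
        ∑ k ∈ Finset.range D, ((k : ℝ) + 1) * |(u k)⁻¹ - 2 * (u (k + 1))⁻¹ + (u (k + 2))⁻¹| ≤
      (2 + 5 * B) * (u (D + 1))⁻¹ := by
  have hB0 : 0 ≤ B := by
    by_contra hneg
    have := hB 0
    have := h1 0
    have := mul_neg_of_neg_of_pos (not_le.1 hneg) (h0 1)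
    norm_num at *
    linarith
  have hinv : ∀ k, (u k)⁻¹ ≤ (u (k + 1))⁻¹ := fun k => inv_anti₀ (h0 _) (h1 k)
  have step : ∀ k : ℕ, ((k : ℝ) + 1) * |(u k)⁻¹ - 2 * (u (k + 1))⁻¹ + (u (k + 2))⁻¹| ≤
      2 * B * ((u (k + 2))⁻¹ - (u k)⁻¹) -
        ((k : ℝ) + 1) * ((u k)⁻¹ - 2 * (u (k + 1))⁻¹ + (u (k + 2))⁻¹) := by
    intro k
    have p0 := h0 k
    have p1 := h0 (k + 1)
    have p2 := h0 (k + 2)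
    have hk : (0 : ℝ) < (k : ℝ) + 1 := by positivity
    set r := (u (k + 1) - u (k + 2)) / u (k + 1) with hr
    set g := (u (k + 2))⁻¹ - (u k)⁻¹ with hg
    set q := (u k - 2 * u (k + 1) + u (k + 2)) / (u k * u (k + 1)) with hq
    have hr0 : 0 ≤ r := div_nonneg (sub_nonneg.2 (h1 (k + 1))) p1.le
    have hg0 : 0 ≤ g := sub_nonneg.2 ((hinv k).trans (hinv (k + 1)))
    have hq0 : 0 ≤ q := div_nonneg (h2 k) (by positivity)
    have hid : (u k)⁻¹ - 2 * (u (k + 1))⁻¹ + (u (k + 2))⁻¹ = r * g - q := by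
      rw [hr, hg, hq]; field_simp; ring
    have hrB : ((k : ℝ) + 1) * r ≤ B := by
      rw [hr, mul_div_assoc', div_le_iff₀ p1]
      refine le_trans (mul_le_mul_of_nonneg_left ?_ hk.le) (hB k)
      linarith [h2 k]
    rw [hid]
    have habs : |r * g - q| ≤ r * g + q := by
      rw [abs_le]; constructor <;> nlinarith [mul_nonneg hr0 hg0]
    have e1 := mul_le_mul_of_nonneg_left habs hk.le
    have e2 := mul_le_mul_of_nonneg_right hrB hg0
    nlinarith
  have hsum : ∀ D : ℕ, ∑ k ∈ Finset.range D,
      ((k : ℝ) + 1) * |(u k)⁻¹ - 2 * (u (k + 1))⁻¹ + (u (k + 2))⁻¹| ≤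
      2 * B * ((u D)⁻¹ + (u (D + 1))⁻¹ - (u 0)⁻¹ - (u 1)⁻¹) -
        (D * ((u (D + 1))⁻¹ - (u D)⁻¹) - ((u D)⁻¹ - (u 0)⁻¹)) := by
    intro D
    induction D with
    | zero => simp
    | succ D ih =>
      rw [Finset.sum_range_succ]
      refine (add_le_add ih (step D)).trans (le_of_eq ?_)
      push_cast
      ring
  have hlast : ((D : ℝ) + 1) * ((u (D + 1))⁻¹ - (u D)⁻¹) ≤ B * (u D)⁻¹ := by
    have p0 := h0 D
    have p1 := h0 (D + 1)
    have : (u (D + 1))⁻¹ - (u D)⁻¹ = (u D - u (D + 1)) * ((u (D + 1))⁻¹ * (u D)⁻¹) := by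
      field_simp
    rw [this, ← mul_assoc]
    refine (mul_le_mul_of_nonneg_right (hB D) (by positivity)).trans (le_of_eq ?_)
    field_simp
  have hS := hsum D
  have i0 : 0 < (u 0)⁻¹ := inv_pos.2 (h0 0)
  have i1 : 0 < (u 1)⁻¹ := inv_pos.2 (h0 1)
  have iD1 : 0 < (u (D + 1))⁻¹ := inv_pos.2 (h0 _)
  have hDn := hinv D
  rw [abs_of_pos iD1, abs_sub_comm, abs_of_nonneg (sub_nonneg.2 hDn)]
  have t1 : 0 ≤ (D : ℝ) * ((u (D + 1))⁻¹ - (u D)⁻¹) :=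
    mul_nonneg (Nat.cast_nonneg _) (sub_nonneg.2 hDn)
  have t2 : B * (u D)⁻¹ ≤ B * (u (D + 1))⁻¹ := mul_le_mul_of_nonneg_left hDn hB0
  have t3 : 0 ≤ B * (u 0)⁻¹ := mul_nonneg hB0 i0.le
  have t4 : 0 ≤ B * (u 1)⁻¹ := mul_nonneg hB0 i1.le
  linarith
section LevelSequence

variable {ω : ℝ → ℝ}

theorem rSeq_spec (hω : IsRadialWeight ω) (hpos : ∀ r ∈ Set.Ico (0:ℝ) 1, 0 < omegaHat ω r)
    {K : ℝ} (hK : 1 < K) (n : ℕ) :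
    rSeq ω K n ∈ Ico (0:ℝ) 1 ∧ omegaHat ω (rSeq ω K n) = omegaHat ω 0 * K ^ (-(n:ℝ)) := by
  have hW := hpos 0 ⟨le_rfl, one_pos⟩
  have hK0 : 0 < K := one_pos.trans hK
  set c := omegaHat ω 0 * K ^ (-(n:ℝ)) with hc
  have hc0 : 0 < c := mul_pos hW (Real.rpow_pos_of_pos hK0 _)
  have hc1 : c ≤ omegaHat ω 0 := mul_le_of_le_one_right hW.le
    (Real.rpow_le_one_of_one_le_of_nonpos hK.le (by simp))
  have h1 : omegaHat ω 1 = 0 := by simp [omegaHat]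
  have hcont := omegaHat_continuousOn hω
  have hS : {r | r ∈ Ico (0:ℝ) 1 ∧ omegaHat ω r = c} = Icc 0 1 ∩ omegaHat ω ⁻¹' {c} := by
    ext r
    constructor
    · rintro ⟨h, h'⟩; exact ⟨⟨h.1, h.2.le⟩, h'⟩
    · rintro ⟨h, h'⟩
      refine ⟨⟨h.1, lt_of_le_of_ne h.2 ?_⟩, h'⟩
      rintro rfl
      rw [Set.mem_preimage, h1, Set.mem_singleton_iff] at h'
      exact hc0.ne h'
  have hclosed : IsClosed {r | r ∈ Ico (0:ℝ) 1 ∧ omegaHat ω r = c} := by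
    rw [hS]; exact hcont.preimage_isClosed_of_isClosed isClosed_Icc isClosed_singleton
  have hne : {r | r ∈ Ico (0:ℝ) 1 ∧ omegaHat ω r = c}.Nonempty := by
    obtain ⟨r, hr, hrc⟩ := intermediate_value_Icc' zero_le_one hcont
      (show c ∈ Icc (omegaHat ω 1) (omegaHat ω 0) from ⟨by rw [h1]; exact hc0.le, hc1⟩)
    rw [hS]; exact ⟨r, hr, hrc⟩
  exact hclosed.csInf_mem hne ⟨0, fun r hr => hr.1.1⟩

theorem MSeq_bounds {K : ℝ} {n : ℕ} (hr : rSeq ω K n ∈ Ico (0:ℝ) 1) :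
    1 ≤ MSeq ω K n ∧ 1 - 1 / (MSeq ω K n : ℝ) ≤ rSeq ω K n ∧
      rSeq ω K n ≤ 1 - 1 / (2 * (MSeq ω K n : ℝ)) := by
  have hd : 0 < 1 - rSeq ω K n := by linarith [hr.2]
  have h1 : 1 ≤ 1 / (1 - rSeq ω K n) := (one_le_div hd).2 (by linarith [hr.1])
  have hM : 1 ≤ MSeq ω K n := Nat.le_floor (by simpa using h1)
  have hM' : (1:ℝ) ≤ MSeq ω K n := by exact_mod_cast hM
  have hle : (MSeq ω K n : ℝ) ≤ 1 / (1 - rSeq ω K n) := Nat.floor_le (by positivity)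
  have hlt : 1 / (1 - rSeq ω K n) < (MSeq ω K n : ℝ) + 1 := Nat.lt_floor_add_one _
  have hM0 : (0:ℝ) < MSeq ω K n := by linarith
  refine ⟨hM, ?_, ?_⟩
  · have := (le_div_comm₀ hM0 hd).1 hle
    linarith
  · have : 1 / (2 * (MSeq ω K n : ℝ)) ≤ 1 - rSeq ω K n := by
      rw [div_le_comm₀ (by positivity) hd]; linarith
    linarith

end LevelSequence

section PowerWeight

variable {ω : ℝ → ℝ} {α : ℝ}

theorem powerWeight_isRadialWeight (hω : IsRadialWeight ω)
    (hpos : ∀ r ∈ Set.Ico (0:ℝ) 1, 0 < omegaHat ω r) (hα : 0 < α) :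
    IsRadialWeight (fun r => ω r * omegaHat ω r ^ (α - 1)) := by
  refine ⟨fun r hr => mul_nonneg (hω.1 r hr) (Real.rpow_nonneg (hpos r hr).le _), ?_⟩
  rw [← intervalIntegrable_iff_integrableOn_Ico_of_le zero_le_one]
  exact (weight_rpow_tail hω hpos hα).1

theorem powerWeight_doubling (hω : IsRadialWeight ω)
    (hpos : ∀ r ∈ Set.Ico (0:ℝ) 1, 0 < omegaHat ω r) (hα : 0 < α) (hD : InDhat ω) :
    ∃ C : ℝ, 1 ≤ C ∧ ∀ r ∈ Ico (0:ℝ) 1,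
      omegaHat (fun r => ω r * omegaHat ω r ^ (α - 1)) r ≤
        C * omegaHat (fun r => ω r * omegaHat ω r ^ (α - 1)) ((1 + r) / 2) := by
  obtain ⟨C, hC, h⟩ := hD
  have hT := (weight_rpow_tail hω hpos hα).2
  refine ⟨(max C 1) ^ α, Real.one_le_rpow (le_max_right _ _) hα.le, fun r hr => ?_⟩
  have hr' : (1 + r) / 2 ∈ Ico (0:ℝ) 1 := ⟨by linarith [hr.1], by linarith [hr.2]⟩
  have p := hpos _ hr'
  change ∫ s in r..1, _ ≤ _ * ∫ s in ((1 + r) / 2)..1, _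
  rw [hT r hr, hT _ hr', ← mul_div_assoc, ← Real.mul_rpow (by positivity) p.le]
  have : omegaHat ω r ≤ max C 1 * omegaHat ω ((1 + r) / 2) :=
    (h r hr).trans (mul_le_mul_of_nonneg_right (le_max_left _ _) p.le)
  have := Real.rpow_le_rpow (hpos r hr).le this hα.le
  gcongr

theorem momentW_MSeq (hω : IsRadialWeight ω)
    (hpos : ∀ r ∈ Set.Ico (0:ℝ) 1, 0 < omegaHat ω r) (hα : 0 < α) (hD : InDhat ω)
    {K : ℝ} (hK : 1 < K) :
    ∃ c > 0, ∃ C > 0, ∀ n : ℕ, 1 ≤ MSeq ω K n ∧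
      c * K ^ (-(α * (n:ℝ))) ≤
        momentW (fun r => ω r * omegaHat ω r ^ (α - 1)) (MSeq ω K n : ℝ) ∧
      momentW (fun r => ω r * omegaHat ω r ^ (α - 1)) (MSeq ω K n : ℝ) ≤
        C * K ^ (-(α * (n:ℝ))) := by
  have hw := powerWeight_isRadialWeight hω hpos hα
  obtain ⟨hint, hT⟩ := weight_rpow_tail hω hpos hα
  obtain ⟨C, hC, hdoub⟩ := powerWeight_doubling hω hpos hα hD
  set μ : ℝ → ℝ := fun r => ω r * omegaHat ω r ^ (α - 1) with hμ
  change ∀ a ∈ Ico (0:ℝ) 1, omegaHat μ a = omegaHat ω a ^ α / α at hT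
  have h0 : ∀ r ∈ Ico (0:ℝ) 1, 0 ≤ omegaHat μ r := fun r hr => by
    rw [hT r hr]; exact div_nonneg (Real.rpow_nonneg (hpos r hr).le _) hα.le
  obtain ⟨B, hB, hup⟩ := momentW_le_tail hw hint hC h0 hdoub
  have hW := hpos 0 ⟨le_rfl, one_pos⟩
  have hK0 : 0 < K := one_pos.trans hK
  set W := omegaHat ω 0 ^ α / α with hWd
  have hW0 : 0 < W := div_pos (Real.rpow_pos_of_pos hW _) hα
  refine ⟨W / (C ^ 2 * 4), by positivity, B * (C * W), by positivity, fun n => ?_⟩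
  obtain ⟨hr, hrn⟩ := rSeq_spec hω hpos hK n
  obtain ⟨hM, hl, hu⟩ := MSeq_bounds hr
  have hTr : omegaHat μ (rSeq ω K n) = W * K ^ (-(α * (n:ℝ))) := by
    rw [hT _ hr, hrn, Real.mul_rpow hW.le (Real.rpow_nonneg hK0.le _), ← Real.rpow_mul hK0.le,
      show -(n:ℝ) * α = -(α * n) by ring, hWd]
    ring
  set M : ℝ := (MSeq ω K n : ℝ) with hMd
  have hM1 : 1 ≤ M := by rw [hMd]; exact_mod_cast hM
  have hM0 : 0 < M := by linarith
  have hM2 : 1 / M ≤ 1 := (div_le_one hM0).2 hM1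
  have hM3 : 0 < 1 / (2 * M) := by positivity
  have hM4 : 2 * (1 / (2 * M)) = 1 / M := by field_simp
  refine ⟨hM, ?_, ?_⟩
  · have a1 := tail_le_momentW_of_doubling hw hint hC h0 hdoub hM1
    have a2 := momentW_anti hw.1 hint hM0 (show M ≤ 4 * M by linarith)
    have a3 := omegaHat_anti hw (by linarith) hl hr.2
    rw [hTr] at a3
    rw [div_mul_eq_mul_div, div_le_iff₀ (by positivity), mul_comm (momentW μ M)]
    exact (a3.trans a1).trans (mul_le_mul_of_nonneg_left a2 (by positivity))
  · have a1 := tail_doubling hw hC h0 hdoub (t := 1 / (2 * M)) hM3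
    rw [hM4, max_eq_right (by linarith), max_eq_right (by linarith)] at a1
    have a2 := omegaHat_anti hw hr.1 hu (by linarith)
    rw [hTr] at a2
    rw [mul_assoc, mul_assoc]
    exact (hup M hM1).trans (mul_le_mul_of_nonneg_left
      (a1.trans (mul_le_mul_of_nonneg_left a2 (by linarith))) hB.le)

end PowerWeight

theorem AdmissibleSpace.nrm_convex_multiplier_le (X : AdmissibleSpace)
    (hpoly : ∀ Q : Polynomial ℂ, (fun z => Q.eval z) ∈ X.carrier)
    {A : ℝ} (hA : ∀ f ∈ X.carrier, ∀ ζ : ℂ, ‖ζ‖ ≤ 1 →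
      (fun z => f (ζ * z)) ∈ X.carrier ∧ X.nrm (fun z => f (ζ * z)) ≤ A * X.nrm f)
    {u : ℕ → ℝ} (h0 : ∀ k, 0 < u k) (h1 : ∀ k, u (k + 1) ≤ u k)
    (h2 : ∀ k, 0 ≤ u k - 2 * u (k + 1) + u (k + 2))
    (b : ℕ → ℂ) (R m D : ℕ)
    (hb : ∀ j, b j ≠ 0 → m ≤ j ∧ j ≤ D) :
    X.nrm (fun z => ∑ j ∈ Finset.range R, ((u j : ℝ) : ℂ) * b j * z ^ j) ≤
      A * u m * X.nrm (fun z => ∑ j ∈ Finset.range R, b j * z ^ j) := by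
  have h := X.nrm_multiplier_le hpoly (fun f hf ζ hζ => (hA f hf ζ hζ).2)
    (fun f hf ζ hζ => (hA f hf ζ hζ).1) b R m D
    (fun j hj => ⟨(hb j hj).1, by have := (hb j hj).2; omega⟩) (fun i => u (m + i))
  rw [convex_multiplier_const (fun i => u (m + i)) (fun k => (h0 _).le) (fun k => h1 _)
    (fun k => h2 _), add_zero] at h
  convert h using 2
  funext z
  refine Finset.sum_congr rfl fun j _ => ?_
  by_cases hj : b j = 0
  · simp [hj]
  · rw [Nat.add_sub_cancel' (hb j hj).1]

theorem AdmissibleSpace.mul_nrm_le_convex_multiplier (X : AdmissibleSpace)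
    (hpoly : ∀ Q : Polynomial ℂ, (fun z => Q.eval z) ∈ X.carrier)
    {A : ℝ} (hA : ∀ f ∈ X.carrier, ∀ ζ : ℂ, ‖ζ‖ ≤ 1 →
      (fun z => f (ζ * z)) ∈ X.carrier ∧ X.nrm (fun z => f (ζ * z)) ≤ A * X.nrm f)
    {u : ℕ → ℝ} (h0 : ∀ k, 0 < u k) (h1 : ∀ k, u (k + 1) ≤ u k)
    (h2 : ∀ k, 0 ≤ u k - 2 * u (k + 1) + u (k + 2))
    {B : ℝ}
    (hB : ∀ k : ℕ, ((k : ℝ) + 1) * (u k - u (k + 1)) ≤ B * u (k + 1)) (hA0 : 0 ≤ A)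
    (b : ℕ → ℂ) (R D : ℕ) (hb : ∀ j, b j ≠ 0 → j ≤ D) :
    u (D + 1) * X.nrm (fun z => ∑ j ∈ Finset.range R, b j * z ^ j) ≤
      A * (2 + 5 * B) *
        X.nrm (fun z => ∑ j ∈ Finset.range R, ((u j : ℝ) : ℂ) * b j * z ^ j) := by
  have hub : ∀ j, ((u j : ℝ) : ℂ) ≠ 0 := fun j => by exact_mod_cast (h0 j).ne'
  have h := X.nrm_multiplier_le hpoly (fun f hf ζ hζ => (hA f hf ζ hζ).2)
    (fun f hf ζ hζ => (hA f hf ζ hζ).1) (fun j => ((u j : ℝ) : ℂ) * b j) R 0 D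
    (fun j hj => ⟨Nat.zero_le _, by have := hb j (right_ne_zero_of_mul hj); omega⟩)
    (fun i => (u i)⁻¹)
  have hc := reciprocal_multiplier_const u h0 h1 h2 hB D
  have hf : (fun z : ℂ => ∑ j ∈ Finset.range R,
      (((u (j - 0))⁻¹ : ℝ) : ℂ) * (((u j : ℝ) : ℂ) * b j) * z ^ j) =
      fun z => ∑ j ∈ Finset.range R, b j * z ^ j := by
    funext z
    refine Finset.sum_congr rfl fun j _ => ?_
    rw [Nat.sub_zero, Complex.ofReal_inv, inv_mul_cancel_left₀ (hub j)]
  rw [hf] at h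
  have hn := X.nrm_nonneg _ (X.polynomial_sum_mem hpoly (fun j => ((u j : ℝ) : ℂ) * b j) R)
  have h' := h.trans (mul_le_mul_of_nonneg_right (mul_le_mul_of_nonneg_left hc hA0) hn)
  have h'' := mul_le_mul_of_nonneg_left h' (h0 (D + 1)).le
  refine h''.trans (le_of_eq ?_)
  have := (h0 (D + 1)).ne'
  field_simp

theorem momentW_le_sq_mul_of_le {μ : ℝ → ℝ} (hw : IsRadialWeight μ)
    (hint : IntervalIntegrable μ volume 0 1) {A : ℝ} (hA0 : 0 < A)
    (hA : ∀ x : ℝ, 1 ≤ x → momentW μ x ≤ A * momentW μ (4 * x)) {x y : ℝ} (hx : 1 ≤ x)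
    (hy : 0 < y) (hxy : y ≤ 16 * x) : momentW μ x ≤ A ^ 2 * momentW μ y :=
  calc momentW μ x ≤ A * momentW μ (4 * x) := hA x hx
    _ ≤ A * (A * momentW μ (4 * (4 * x))) := by gcongr; exact hA _ (by linarith)
    _ ≤ A * (A * momentW μ y) := by
        gcongr
        exact momentW_anti hw.1 hint hy (by linarith)
    _ = A ^ 2 * momentW μ y := by ring

/-- Norm estimate `‖I^μ(P_n∗g)‖_X ≍ μ_{M_n} ‖P_n∗g‖_X ≍ K^{-αn}‖P_n∗g‖_X`
for every admissible Banach space `X` containing the polynomials. -/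
theorem Imu_hadamard_norm_estimate
    (ω : ℝ → ℝ) (hω : IsRadialWeight ω)
    (hpos : ∀ r ∈ Set.Ico (0:ℝ) 1, 0 < omegaHat ω r)
    (hD : InDhat ω)
    (N : ℕ) (hN : 1 ≤ N) (α : ℝ) (hα : 0 < α)
    (μ : ℝ → ℝ) (hμ : μ = fun r => ω r * omegaHat ω r ^ (α - 1))
    (K : ℝ) (hK : 1 < K)
    (hlac : ∃ c > (1:ℝ), ∀ n : ℕ,
      MSeq ω K n < MSeq ω K (n + 1) ∧ c * (MSeq ω K n : ℝ) ≤ (MSeq ω K (n + 1) : ℝ))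
    (P : ℕ → Polynomial ℂ)
    (hP : ∀ n j : ℕ,
      ¬ ((if n = 0 then 0 else MSeq ω K (n - 1)) ≤ j ∧ j < MSeq ω K (n + N)) →
      (P n).coeff j = 0)
    (X : AdmissibleSpace)
    (hpoly : ∀ Q : Polynomial ℂ, (fun z => Q.eval z) ∈ X.carrier) :
    ∃ c > (0:ℝ), ∃ C > (0:ℝ), ∀ n : ℕ, ∀ g : ℂ → ℂ,
      DifferentiableOn ℂ g (Metric.ball 0 1) →
      (c * K ^ (-(α * (n:ℝ))) * X.nrm (hadamardPolyC (fun _ => 1) (P n) g) ≤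
          X.nrm (hadamardPolyC (fun j => ((momentW μ (2 * (j:ℝ) + 1) : ℝ) : ℂ)) (P n) g) ∧
        X.nrm (hadamardPolyC (fun j => ((momentW μ (2 * (j:ℝ) + 1) : ℝ) : ℂ)) (P n) g) ≤
          C * K ^ (-(α * (n:ℝ))) * X.nrm (hadamardPolyC (fun _ => 1) (P n) g)) ∧
      (c * momentW μ (MSeq ω K n : ℝ) * X.nrm (hadamardPolyC (fun _ => 1) (P n) g) ≤
          X.nrm (hadamardPolyC (fun j => ((momentW μ (2 * (j:ℝ) + 1) : ℝ) : ℂ)) (P n) g) ∧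
        X.nrm (hadamardPolyC (fun j => ((momentW μ (2 * (j:ℝ) + 1) : ℝ) : ℂ)) (P n) g) ≤
          C * momentW μ (MSeq ω K n : ℝ) * X.nrm (hadamardPolyC (fun _ => 1) (P n) g)) := by
  subst hμ
  set μ : ℝ → ℝ := fun r => ω r * omegaHat ω r ^ (α - 1) with hμ
  have hw : IsRadialWeight μ := powerWeight_isRadialWeight hω hpos hα
  obtain ⟨hint, htail⟩ := weight_rpow_tail hω hpos hα
  obtain ⟨C₀, hC₀, hdbl⟩ := powerWeight_doubling hω hpos hα hD
  have htail' : ∀ r ∈ Ico (0:ℝ) 1, 0 < omegaHat μ r := fun r hr => by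
    have := Real.rpow_pos_of_pos (hpos r hr) α
    rw [show omegaHat μ r = omegaHat ω r ^ α / α from htail r hr]
    positivity
  have hE : ∀ x : ℝ, 0 ≤ x → 0 < momentW μ x := fun x hx =>
    lt_of_lt_of_le (mul_pos (Real.rpow_pos_of_pos (by norm_num) x)
      (htail' (1 / 2) ⟨by norm_num, by norm_num⟩))
      (rpow_mul_tail_le_momentW hw.1 hint hx ⟨by norm_num, by norm_num⟩)
  obtain ⟨A₀, hA₀, hA₀d⟩ := momentW_doubling hw hint hC₀ (fun r hr => (htail' r hr).le) hdbl
  have hE2 : ∀ {x y : ℝ}, 1 ≤ x → 0 < y → y ≤ 16 * x → momentW μ x ≤ A₀ ^ 2 * momentW μ y :=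
    fun hx hy hxy => momentW_le_sq_mul_of_le hw hint hA₀ hA₀d hx hy hxy
  have hu0 : ∀ k, 0 < momentCoeff μ k := fun k => hE _ (by positivity)
  have hu1 : ∀ k, momentCoeff μ (k + 1) ≤ momentCoeff μ k := fun k =>
    momentW_anti hw.1 hint (by positivity) (by push_cast; linarith)
  have hu2 := momentCoeff_convex hw hint
  have huB : ∀ k : ℕ, ((k : ℝ) + 1) * (momentCoeff μ k - momentCoeff μ (k + 1)) ≤
      2 * A₀ ^ 2 * momentCoeff μ (k + 1) := fun k => by
    have h1 := mul_sub_le_of_convex (fun k => (hu0 k).le) hu2 k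
    have hk : (k : ℝ) ≤ 2 * ((k / 2 : ℕ) : ℝ) + 1 := by
      exact_mod_cast (by omega : k ≤ 2 * (k / 2) + 1)
    have h0 : (0 : ℝ) ≤ ((k / 2 : ℕ) : ℝ) := Nat.cast_nonneg _
    have h2 : momentCoeff μ (k / 2) ≤ A₀ ^ 2 * momentCoeff μ (k + 1) :=
      hE2 (by linarith) (by positivity) (by push_cast; linarith)
    linarith
  obtain ⟨A, hA, hAd⟩ := X.dilation_bound
  obtain ⟨c₁, hc₁, C₁, hC₁, hM⟩ := momentW_MSeq hω hpos hα hD hK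
  have hK0 : 0 < K := by linarith
  have hlow : ∀ n : ℕ, momentCoeff μ (if n = 0 then 0 else MSeq ω K (n - 1)) ≤
      (momentCoeff μ 0 + C₁ * K ^ α) * K ^ (-(α * (n:ℝ))) := by
    intro n
    have hq : 0 < K ^ (-(α * (n:ℝ))) := Real.rpow_pos_of_pos hK0 _
    have hKα := Real.rpow_pos_of_pos hK0 α
    rcases n with _ | n
    · simp only [if_true, Nat.cast_zero, mul_zero, neg_zero, Real.rpow_zero, mul_one]
      linarith [mul_pos hC₁ hKα]
    · have h1 : (1:ℝ) ≤ MSeq ω K n := by exact_mod_cast (hM n).1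
      have h2 : momentCoeff μ (MSeq ω K n) ≤ momentW μ (MSeq ω K n : ℝ) :=
        momentW_anti hw.1 hint (by linarith) (by linarith)
      have h3 : K ^ (-(α * (n:ℝ))) = K ^ α * K ^ (-(α * ((n + 1 : ℕ):ℝ))) := by
        rw [← Real.rpow_add hK0]; push_cast; ring_nf
      have h4 := (hM n).2.2
      rw [h3] at h4
      have h5 := mul_pos (hu0 0) hq
      simp only [Nat.add_eq_zero_iff, one_ne_zero, and_false, if_false, Nat.add_sub_cancel]
      calc _ ≤ _ := h2
        _ ≤ _ := h4
        _ ≤ _ := by rw [add_mul, mul_assoc C₁]; linarith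
  have hhigh : ∀ n : ℕ, c₁ * K ^ (-(α * (N:ℝ))) * K ^ (-(α * (n:ℝ))) ≤
      A₀ ^ 2 * momentCoeff μ (MSeq ω K (n + N) + 1) := by
    intro n
    have h1 : (1:ℝ) ≤ MSeq ω K (n + N) := by exact_mod_cast (hM (n + N)).1
    have h2 : momentW μ (MSeq ω K (n + N) : ℝ) ≤
        A₀ ^ 2 * momentCoeff μ (MSeq ω K (n + N) + 1) :=
      hE2 h1 (by positivity) (by push_cast; linarith)
    have h3 := (hM (n + N)).2.1
    rw [show -(α * ((n + N : ℕ):ℝ)) = -(α * (N:ℝ)) + -(α * (n:ℝ)) by push_cast; ring,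
      Real.rpow_add hK0, ← mul_assoc] at h3
    exact h3.trans h2
  set U : ℝ := A * (momentCoeff μ 0 + C₁ * K ^ α) with hU
  set L : ℝ := c₁ * K ^ (-(α * (N:ℝ))) / (A₀ ^ 2 * (A * (2 + 5 * (2 * A₀ ^ 2)))) with hL
  have hKα := Real.rpow_pos_of_pos hK0 α
  have hKN := Real.rpow_pos_of_pos hK0 (-(α * (N:ℝ)))
  have hUpos : 0 < U := by have := hu0 0; positivity
  have hLpos : 0 < L := by positivity
  refine ⟨min L (L / C₁), by positivity, max U (U / c₁), by positivity, fun n g _ => ?_⟩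
  set b : ℕ → ℂ := fun j => (P n).coeff j * taylorCoeff g j with hb
  have hbsupp : ∀ j, b j ≠ 0 →
      (if n = 0 then 0 else MSeq ω K (n - 1)) ≤ j ∧ j < MSeq ω K (n + N) := fun j hj => by
    by_contra hcon
    exact left_ne_zero_of_mul hj (hP n j hcon)
  have e1 : hadamardPolyC (fun _ => 1) (P n) g =
      fun z => ∑ j ∈ Finset.range ((P n).natDegree + 1), b j * z ^ j := by
    funext z
    simp only [hadamardPolyC, one_mul, hb]
  have e2 : hadamardPolyC (fun j => ((momentW μ (2 * (j:ℝ) + 1) : ℝ) : ℂ)) (P n) g =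
      fun z => ∑ j ∈ Finset.range ((P n).natDegree + 1),
        ((momentCoeff μ j : ℝ) : ℂ) * b j * z ^ j := by
    funext z
    simp only [hadamardPolyC, momentCoeff, hb, mul_assoc]
  have up := X.nrm_convex_multiplier_le hpoly hAd hu0 hu1 hu2 b ((P n).natDegree + 1) _ _
    (fun j hj => ⟨(hbsupp j hj).1, (hbsupp j hj).2.le⟩)
  have lo := X.mul_nrm_le_convex_multiplier hpoly hAd hu0 hu1 hu2 huB hA.le b
    ((P n).natDegree + 1) _ (fun j hj => (hbsupp j hj).2.le)
  have hn := X.nrm_nonneg _ (X.polynomial_sum_mem hpoly b ((P n).natDegree + 1))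
  rw [← e1, ← e2] at up lo
  rw [← e1] at hn
  set F : ℝ := X.nrm (hadamardPolyC (fun _ => 1) (P n) g)
  set G : ℝ := X.nrm (hadamardPolyC (fun j => ((momentW μ (2 * (j:ℝ) + 1) : ℝ) : ℂ)) (P n) g)
  set q : ℝ := K ^ (-(α * (n:ℝ))) with hq
  have hq0 : 0 < q := Real.rpow_pos_of_pos hK0 _
  have hup : G ≤ U * q * F := up.trans (by
    rw [hU, mul_assoc A _ q]
    gcongr
    exact hlow n)
  have hlo : L * q * F ≤ G := by
    have h1 := mul_le_mul_of_nonneg_right (hhigh n) hn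
    have h2 := mul_le_mul_of_nonneg_left lo (sq_nonneg A₀)
    rw [hL, div_mul_eq_mul_div, div_mul_eq_mul_div, div_le_iff₀ (by positivity)]
    linarith
  obtain ⟨-, hm1, hm2⟩ := hM n
  have hE0 : 0 < momentW μ (MSeq ω K n : ℝ) := hE _ (Nat.cast_nonneg _)
  refine ⟨⟨le_trans ?_ hlo, hup.trans ?_⟩, le_trans ?_ hlo, hup.trans ?_⟩
  · gcongr
    exact min_le_left _ _
  · gcongr
    exact le_max_left _ _
  · refine mul_le_mul_of_nonneg_right ?_ hn
    calc min L (L / C₁) * momentW μ (MSeq ω K n : ℝ) ≤ L / C₁ * (C₁ * q) := by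
          gcongr
          exact min_le_right _ _
      _ = L * q := by field_simp
  · refine mul_le_mul_of_nonneg_right ?_ hn
    calc U * q = U / c₁ * (c₁ * q) := by field_simp
      _ ≤ max U (U / c₁) * momentW μ (MSeq ω K n : ℝ) := by
          gcongr
          exact le_max_right _ _
end
end

section
/- Let ω be a radial weight in the class D̂. Let Ψ:ℝ→ℝ be a C^∞ function with Ψ≡1 on (−∞,1], Ψ≡0 on [2,∞), and Ψ decreasing and positive on (1,2); set ψ(t)=Ψ(t/2)−Ψ(t) and, for n∈ℕ, V_n(z)=∑_{j=2^{n−1}}^{2^{n+1}−1} ψ(j/2^{n−1})·z^j. Define D^ω g(z)=∑_{k≥0} ĝ(k)·z^k/(2ω_{2k+1}). Then there exists a constant C>0 (depending only on ω and Ψ) such that for all n∈ℕ and all g∈H(D): ‖D^ω(V_n∗g)‖_{H¹} ≤ C·(ω_{2^{n+2}})^{−1}·‖V_n∗g‖_{H¹}. -/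
open MeasureTheory Filter Set
open scoped ENNReal

noncomputable section

/-- The `L¹` norm of a function over one period. -/
def periodL1 (F : ℝ → ℂ) : ℝ := ∫ θ in (0:ℝ)..(2 * Real.pi), ‖F θ‖

/-- The trigonometric polynomial with frequencies in `s` and coefficients `a`. -/
def trigPoly (s : Finset ℕ) (a : ℕ → ℂ) (θ : ℝ) : ℂ :=
  ∑ j ∈ s, a j * Complex.exp (j * (θ * Complex.I))

/-- The coefficient multiplier `c` is bounded by `B` in `L¹` on polynomials with
frequencies in `s`. -/
def IsL1Multiplier (s : Finset ℕ) (c : ℕ → ℝ) (B : ℝ) : Prop :=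
  ∀ a : ℕ → ℂ, periodL1 (trigPoly s fun j => c j * a j) ≤ B * periodL1 (trigPoly s a)

lemma continuous_trigPoly (s : Finset ℕ) (a : ℕ → ℂ) : Continuous (trigPoly s a) := by
  unfold trigPoly; fun_prop

lemma periodL1_nonneg (F : ℝ → ℂ) : 0 ≤ periodL1 F :=
  intervalIntegral.integral_nonneg (by positivity) fun _ _ => norm_nonneg _

lemma periodL1_add_le {F G : ℝ → ℂ} (hF : Continuous F) (hG : Continuous G) :
    periodL1 (fun θ => F θ + G θ) ≤ periodL1 F + periodL1 G := by
  unfold periodL1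
  rw [← intervalIntegral.integral_add (hF.norm.intervalIntegrable _ _)
    (hG.norm.intervalIntegrable _ _)]
  exact intervalIntegral.integral_mono_on (by positivity)
    ((hF.add hG).norm.intervalIntegrable _ _)
    ((hF.norm.add hG.norm).intervalIntegrable _ _) fun θ _ => norm_add_le _ _

lemma periodL1_const_mul (c : ℂ) (F : ℝ → ℂ) :
    periodL1 (fun θ => c * F θ) = ‖c‖ * periodL1 F := by
  simp [periodL1, intervalIntegral.integral_const_mul]

lemma periodL1_sum_le {ι : Type*} (u : Finset ι) (F : ι → ℝ → ℂ) (hF : ∀ i, Continuous (F i)) :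
    periodL1 (fun θ => ∑ i ∈ u, F i θ) ≤ ∑ i ∈ u, periodL1 (F i) := by
  classical
  induction u using Finset.induction_on with
  | empty => simp [periodL1]
  | insert i u hi ih =>
    simp only [Finset.sum_insert hi]
    have := periodL1_add_le (hF i) (continuous_finsetSum u fun i _ => hF i)
    linarith

lemma trigPoly_add_two_pi (s : Finset ℕ) (a : ℕ → ℂ) :
    Function.Periodic (trigPoly s a) (2 * Real.pi) := by
  intro θ
  refine Finset.sum_congr rfl fun j _ => ?_
  congr 1
  rw [Complex.exp_eq_exp_iff_exists_int]
  exact ⟨j, by push_cast; ring⟩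

lemma periodL1_trigPoly_add (s : Finset ℕ) (a : ℕ → ℂ) (t : ℝ) :
    periodL1 (fun θ => trigPoly s a (θ + t)) = periodL1 (trigPoly s a) := by
  have hp : Function.Periodic (fun θ => ‖trigPoly s a θ‖) (2 * Real.pi) := fun θ => by
    simp only [trigPoly_add_two_pi s a θ]
  unfold periodL1
  rw [intervalIntegral.integral_comp_add_right (fun θ => ‖trigPoly s a θ‖) t]
  have := hp.intervalIntegral_add_eq t 0
  simpa [add_comm] using this

namespace IsL1Multiplier

variable {s : Finset ℕ} {c d : ℕ → ℝ} {A B : ℝ}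

lemma mono (h : IsL1Multiplier s c A) (hAB : A ≤ B) : IsL1Multiplier s c B := fun a =>
  (h a).trans (mul_le_mul_of_nonneg_right hAB (periodL1_nonneg _))

lemma congr (h : IsL1Multiplier s c B) (hcd : ∀ j ∈ s, c j = d j) : IsL1Multiplier s d B := by
  intro a
  have : trigPoly s (fun j => d j * a j) = trigPoly s (fun j => c j * a j) := by
    funext θ
    exact Finset.sum_congr rfl fun j hj => by simp only [hcd j hj]
  rw [this]
  exact h a

lemma add (hc : IsL1Multiplier s c A) (hd : IsL1Multiplier s d B) :
    IsL1Multiplier s (fun j => c j + d j) (A + B) := by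
  intro a
  have : trigPoly s (fun j => ((c j + d j : ℝ) : ℂ) * a j) = fun θ =>
      trigPoly s (fun j => c j * a j) θ + trigPoly s (fun j => d j * a j) θ := by
    funext θ
    simp only [trigPoly, ← Finset.sum_add_distrib]
    exact Finset.sum_congr rfl fun j _ => by push_cast; ring
  rw [this]
  have := periodL1_add_le (continuous_trigPoly s fun j => c j * a j)
    (continuous_trigPoly s fun j => d j * a j)
  linarith [hc a, hd a]

lemma const (s : Finset ℕ) (x : ℝ) : IsL1Multiplier s (fun _ => x) |x| := by
  intro a
  have : trigPoly s (fun j => (x : ℂ) * a j) = fun θ => x * trigPoly s a θ := by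
    funext θ
    simp only [trigPoly, Finset.mul_sum, mul_assoc]
  rw [this, periodL1_const_mul]
  simp

lemma const_mul (x : ℝ) (hc : IsL1Multiplier s c B) :
    IsL1Multiplier s (fun j => x * c j) (|x| * B) := by
  intro a
  have : trigPoly s (fun j => ((x * c j : ℝ) : ℂ) * a j) =
      fun θ => x * trigPoly s (fun j => c j * a j) θ := by
    funext θ
    simp only [trigPoly, Finset.mul_sum]
    exact Finset.sum_congr rfl fun j _ => by push_cast; ring
  rw [this, periodL1_const_mul, Complex.norm_real, Real.norm_eq_abs, mul_assoc]
  exact mul_le_mul_of_nonneg_left (hc a) (abs_nonneg x)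

lemma sum {ι : Type*} (u : Finset ι) {c : ι → ℕ → ℝ} {B : ι → ℝ}
    (h : ∀ i ∈ u, IsL1Multiplier s (c i) (B i)) :
    IsL1Multiplier s (fun j => ∑ i ∈ u, c i j) (∑ i ∈ u, B i) := by
  classical
  induction u using Finset.induction_on with
  | empty => simpa using const s 0
  | insert i u hi ih =>
    simp only [Finset.sum_insert hi]
    exact (h i (Finset.mem_insert_self i u)).add
      (ih fun k hk => h k (Finset.mem_insert_of_mem hk))

/-- A positive combination of rotations is a multiplier bounded by its total mass. -/
lemma of_rotations {ι : Type*} (u : Finset ι) {w t : ι → ℝ} (hw : ∀ i, 0 ≤ w i)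
    (h : ∀ j ∈ s, ∑ i ∈ u, (w i : ℂ) * Complex.exp (j * (t i * Complex.I)) = c j) :
    IsL1Multiplier s c (∑ i ∈ u, w i) := by
  intro a
  have : trigPoly s (fun j => c j * a j) =
      fun θ => ∑ i ∈ u, w i * trigPoly s a (θ + t i) := by
    funext θ
    simp only [trigPoly, Finset.mul_sum]
    rw [Finset.sum_comm]
    refine Finset.sum_congr rfl fun j hj => ?_
    rw [← h j hj, Finset.sum_mul, Finset.sum_mul]
    refine Finset.sum_congr rfl fun i _ => ?_
    rw [Complex.ofReal_add, add_mul, mul_add, Complex.exp_add]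
    ring
  rw [this, Finset.sum_mul]
  refine (periodL1_sum_le u _ fun i => ?_).trans (Finset.sum_le_sum fun i _ => ?_)
  · exact continuous_const.mul ((continuous_trigPoly s a).comp (continuous_add_const _))
  · rw [periodL1_const_mul, periodL1_trigPoly_add, Complex.norm_real, Real.norm_of_nonneg (hw i)]

end IsL1Multiplier

lemma sum_pow_mul_conj_eq {ζ : ℂ} {L a b : ℕ} (hζ : IsPrimitiveRoot ζ L) (ha : a < L) (hb : b < L) :
    ∑ ν ∈ Finset.range L, (ζ ^ ν) ^ a * (starRingEnd ℂ) ((ζ ^ ν) ^ b) =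
      if a = b then (L : ℂ) else 0 := by
  have hn : ‖ζ‖ = 1 := hζ.norm'_eq_one (by omega)
  have h0 : ζ ≠ 0 := hζ.ne_zero (by omega)
  have hc : (starRingEnd ℂ) ζ = ζ⁻¹ := (Complex.inv_eq_conj hn).symm
  have hterm : ∀ ν, (ζ ^ ν) ^ a * (starRingEnd ℂ) ((ζ ^ ν) ^ b) = (ζ ^ a * (ζ⁻¹) ^ b) ^ ν := by
    intro ν
    simp only [map_pow, hc, mul_pow, ← pow_mul, mul_comm]
  simp only [hterm]
  split_ifs with hab
  · subst hab
    simp [h0]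
  · have hne : ζ ^ a * (ζ⁻¹) ^ b ≠ 1 := by
      intro h
      apply hab
      apply hζ.pow_inj ha hb
      rw [inv_pow] at h
      field_simp at h
      exact h
    have hpow : (ζ ^ a * (ζ⁻¹) ^ b) ^ L = 1 := by
      rw [mul_pow, pow_right_comm, pow_right_comm ζ⁻¹, inv_pow, hζ.pow_eq_one]
      simp
    rw [geom_sum_eq hne, hpow, sub_self, zero_div]

lemma exists_fejer_rotations (M k : ℕ) :
    ∃ (L : ℕ) (w t : ℕ → ℝ), (∀ i, 0 ≤ w i) ∧ ∀ j ≤ M,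
      ∑ i ∈ Finset.range L, (w i : ℂ) * Complex.exp (j * (t i * Complex.I)) =
        (((k + 1 - j : ℕ) : ℝ) : ℂ) := by
  set L := M + k + 1 with hL
  have hL0 : (L : ℂ) ≠ 0 := by simp [hL]; norm_cast
  set ζ := Complex.exp (2 * Real.pi * Complex.I / L) with hζ
  have hprim : IsPrimitiveRoot ζ L := Complex.isPrimitiveRoot_exp L (by omega)
  refine ⟨L, fun ν => ‖∑ l ∈ Finset.range (k + 1), (ζ ^ ν) ^ l‖ ^ 2 / L,
    fun ν => 2 * Real.pi * ν / L, fun i => by positivity, fun j hj => ?_⟩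
  have hexp : ∀ ν : ℕ, Complex.exp (j * ((2 * Real.pi * ν / L : ℝ) * Complex.I)) = (ζ ^ ν) ^ j := by
    intro ν
    rw [hζ, ← Complex.exp_nat_mul, ← Complex.exp_nat_mul]
    congr 1
    push_cast
    ring
  have hexpand : ∀ ν : ℕ, ((‖∑ l ∈ Finset.range (k + 1), (ζ ^ ν) ^ l‖ ^ 2 / L : ℝ) : ℂ) *
      Complex.exp (j * ((2 * Real.pi * ν / L : ℝ) * Complex.I)) =
      (∑ l ∈ Finset.range (k + 1), ∑ l' ∈ Finset.range (k + 1),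
        (ζ ^ ν) ^ (l + j) * (starRingEnd ℂ) ((ζ ^ ν) ^ l')) / L := by
    intro ν
    rw [hexp]
    push_cast
    rw [← Complex.mul_conj', map_sum, Finset.sum_mul_sum, div_mul_eq_mul_div, Finset.sum_mul]
    congr 1
    refine Finset.sum_congr rfl fun l _ => ?_
    rw [Finset.sum_mul]
    exact Finset.sum_congr rfl fun l' _ => by ring
  rw [Finset.sum_congr rfl fun ν _ => hexpand ν, ← Finset.sum_div, Finset.sum_comm,
    div_eq_iff hL0]
  have hinner : ∀ l ∈ Finset.range (k + 1), ∑ ν ∈ Finset.range L, ∑ l' ∈ Finset.range (k + 1),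
      (ζ ^ ν) ^ (l + j) * (starRingEnd ℂ) ((ζ ^ ν) ^ l') =
      if l < k + 1 - j then (L : ℂ) else 0 := by
    intro l hl
    rw [Finset.mem_range] at hl
    rw [Finset.sum_comm, Finset.sum_congr rfl fun l' hl' => sum_pow_mul_conj_eq hprim
      (a := l + j) (b := l') (by omega) (by rw [Finset.mem_range] at hl'; omega)]
    rw [Finset.sum_ite_eq]
    simp only [Finset.mem_range]
    congr 1
    simp only [eq_iff_iff]
    omega
  rw [Finset.sum_congr rfl hinner, ← Finset.sum_filter, Finset.sum_const, nsmul_eq_mul]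
  congr 1
  have : (Finset.range (k + 1)).filter (· < k + 1 - j) = Finset.range (k + 1 - j) := by
    ext l; simp only [Finset.mem_filter, Finset.mem_range]; omega
  rw [this, Finset.card_range]
  push_cast
  rfl

lemma isL1Multiplier_cesaro (s : Finset ℕ) (k : ℕ) :
    IsL1Multiplier s (fun j => ((k + 1 - j : ℕ) : ℝ)) (k + 1) := by
  obtain ⟨L, w, t, hw, h⟩ := exists_fejer_rotations (s.sup id) k
  have hmass : ∑ i ∈ Finset.range L, w i = k + 1 := by
    have := h 0 (Nat.zero_le _)
    simp only [Nat.cast_zero, zero_mul, Complex.exp_zero, mul_one, Nat.sub_zero] at this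
    exact_mod_cast this
  rw [← hmass]
  exact IsL1Multiplier.of_rotations _ hw fun j hj => h j (Finset.le_sup (f := id) hj)

lemma eq_sum_second_difference (m : ℕ → ℝ) (N : ℕ) {j M : ℕ} (hN : N ≤ j) (hM : j ≤ M) :
    m j = m M + (m M - m (M + 1)) * ((M - j : ℕ) : ℝ) +
      ∑ k ∈ Finset.Ico N M, (m k - 2 * m (k + 1) + m (k + 2)) * ((k + 1 - j : ℕ) : ℝ) := by
  induction M, hM using Nat.le_induction with
  | base =>
    have : ∑ k ∈ Finset.Ico N j, (m k - 2 * m (k + 1) + m (k + 2)) * ((k + 1 - j : ℕ) : ℝ) = 0 := by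
      refine Finset.sum_eq_zero fun k hk => ?_
      rw [Finset.mem_Ico] at hk
      rw [show k + 1 - j = 0 by omega]
      simp
    simp [this]
  | succ M hM ih =>
    rw [Finset.sum_Ico_succ_top (hN.trans hM), ih, Nat.succ_sub hM]
    push_cast
    ring

/-- An `L¹` multiplier bound by weighted second differences. -/
lemma isL1Multiplier_of_second_difference (m : ℕ → ℝ) (N M : ℕ) {s : Finset ℕ}
    (hs : s ⊆ Finset.Icc N (M + 1)) :
    IsL1Multiplier s m (|m (M + 1)| + |m (M + 1) - m (M + 2)| * (M + 1) +
      ∑ k ∈ Finset.Ico N (M + 1), |m k - 2 * m (k + 1) + m (k + 2)| * (k + 1)) := by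
  refine (((IsL1Multiplier.const s (m (M + 1))).add
    ((isL1Multiplier_cesaro s M).const_mul (m (M + 1) - m (M + 2)))).add
    (IsL1Multiplier.sum (Finset.Ico N (M + 1)) fun k _ =>
      (isL1Multiplier_cesaro s k).const_mul (m k - 2 * m (k + 1) + m (k + 2)))).congr
      fun j hj => ?_
  have := Finset.mem_Icc.1 (hs hj)
  exact (eq_sum_second_difference m N this.1 this.2).symm

lemma momentW_natCast (ω : ℝ → ℝ) (k : ℕ) :
    momentW ω (k : ℝ) = ∫ r in Ioo (0:ℝ) 1, r ^ k * ω r := by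
  simp only [momentW, Real.rpow_natCast]
  rw [intervalIntegral.integral_of_le zero_le_one, integral_Ioc_eq_integral_Ioo]

lemma omegaHat_eq_integral_Ioo (ω : ℝ → ℝ) {r : ℝ} (hr : r ≤ 1) :
    omegaHat ω r = ∫ s in Ioo r 1, ω s := by
  rw [omegaHat, intervalIntegral.integral_of_le hr, integral_Ioc_eq_integral_Ioo]

namespace IsRadialWeight

variable {ω : ℝ → ℝ}

lemma nonneg (hω : IsRadialWeight ω) {r : ℝ} (hr : r ∈ Ioo (0:ℝ) 1) : 0 ≤ ω r :=
  hω.1 r (Ioo_subset_Ico_self hr)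

lemma integrableOn_Ioo (hω : IsRadialWeight ω) : IntegrableOn ω (Ioo 0 1) :=
  hω.2.mono_set Ioo_subset_Ico_self

lemma integrableOn_mul (hω : IsRadialWeight ω) {p : ℝ → ℝ} (hp : Continuous p) :
    IntegrableOn (fun r => p r * ω r) (Ioo 0 1) :=
  hω.integrableOn_Ioo.continuousOn_mul_of_subset hp.continuousOn
    isCompact_Icc measurableSet_Ioo Ioo_subset_Icc_self

lemma integral_mul_mono (hω : IsRadialWeight ω) {p q : ℝ → ℝ} (hp : Continuous p)
    (hq : Continuous q) (h : ∀ r ∈ Ioo (0:ℝ) 1, p r ≤ q r) :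
    ∫ r in Ioo (0:ℝ) 1, p r * ω r ≤ ∫ r in Ioo (0:ℝ) 1, q r * ω r :=
  setIntegral_mono_on (hω.integrableOn_mul hp) (hω.integrableOn_mul hq) measurableSet_Ioo
    fun r hr => mul_le_mul_of_nonneg_right (h r hr) (hω.nonneg hr)

lemma integral_mul_nonneg (hω : IsRadialWeight ω) {p : ℝ → ℝ}
    (h : ∀ r ∈ Ioo (0:ℝ) 1, 0 ≤ p r) : 0 ≤ ∫ r in Ioo (0:ℝ) 1, p r * ω r :=
  setIntegral_nonneg measurableSet_Ioo fun r hr => mul_nonneg (h r hr) (hω.nonneg hr)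

lemma momentW_antitone (hω : IsRadialWeight ω) {k l : ℕ} (hkl : k ≤ l) :
    momentW ω (l : ℝ) ≤ momentW ω (k : ℝ) := by
  rw [momentW_natCast, momentW_natCast]
  exact hω.integral_mul_mono (continuous_pow l) (continuous_pow k) fun r hr =>
    pow_le_pow_of_le_one hr.1.le hr.2.le hkl

lemma momentW_pos (hω : IsRadialWeight ω) (hpos : ∀ r ∈ Ico (0:ℝ) 1, 0 < omegaHat ω r)
    (k : ℕ) : 0 < momentW ω (k : ℝ) := by
  have hsub : Ioo (1/2 : ℝ) 1 ⊆ Ioo 0 1 := Ioo_subset_Ioo_left (by norm_num)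
  have h := hpos (1/2) (by norm_num)
  rw [omegaHat_eq_integral_Ioo ω (by norm_num)] at h
  rw [momentW_natCast]
  calc 0 < (1/2 : ℝ) ^ k * ∫ s in Ioo (1/2 : ℝ) 1, ω s := by positivity
    _ = ∫ s in Ioo (1/2 : ℝ) 1, (1/2 : ℝ) ^ k * ω s := (integral_const_mul _ _).symm
    _ ≤ ∫ s in Ioo (1/2 : ℝ) 1, s ^ k * ω s := by
        refine setIntegral_mono_on ((hω.integrableOn_Ioo.mono_set hsub).const_mul _)
          ((hω.integrableOn_mul (continuous_pow k)).mono_set hsub) measurableSet_Ioo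
          fun s hs => mul_le_mul_of_nonneg_right ?_ (hω.nonneg (hsub hs))
        exact pow_le_pow_left₀ (by norm_num) hs.1.le k
    _ ≤ ∫ s in Ioo (0 : ℝ) 1, s ^ k * ω s := by
        refine setIntegral_mono_set (hω.integrableOn_mul (continuous_pow k)) ?_
          hsub.eventuallyLE
        filter_upwards [ae_restrict_mem measurableSet_Ioo] with s hs
        exact mul_nonneg (pow_nonneg hs.1.le k) (hω.nonneg hs)

/-- The measure `ω(r) dr` on `(0,1)`. -/
def toMeasure (ω : ℝ → ℝ) : Measure ℝ :=
  (volume.restrict (Ioo 0 1)).withDensity fun r => ENNReal.ofReal (ω r)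

lemma toMeasure_Ico (hω : IsRadialWeight ω) {r : ℝ} (hr : r ∈ Ioo (0:ℝ) 1) :
    toMeasure ω (Ico r 1) = ENNReal.ofReal (omegaHat ω r) := by
  have hsub : Ioo r 1 ⊆ Ioo 0 1 := Ioo_subset_Ioo_left hr.1.le
  have hsub' : Ico r 1 ⊆ Ioo 0 1 := fun s hs => ⟨hr.1.trans_le hs.1, hs.2⟩
  rw [toMeasure, withDensity_apply _ measurableSet_Ico, Measure.restrict_restrict measurableSet_Ico,
    inter_eq_left.2 hsub', omegaHat_eq_integral_Ioo ω hr.2.le,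
    ofReal_integral_eq_lintegral_ofReal (hω.integrableOn_Ioo.mono_set hsub),
    Measure.restrict_congr_set Ioo_ae_eq_Ico]
  filter_upwards [ae_restrict_mem measurableSet_Ioo] with s hs
  exact hω.nonneg (hsub hs)

lemma lintegral_pow_toMeasure (hω : IsRadialWeight ω) (k : ℕ) :
    ∫⁻ r, ENNReal.ofReal (r ^ k) ∂toMeasure ω = ENNReal.ofReal (momentW ω (k : ℝ)) := by
  rw [momentW_natCast, ofReal_integral_eq_lintegral_ofReal (hω.integrableOn_mul (continuous_pow k)),
    toMeasure, lintegral_withDensity_eq_lintegral_mul₀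
      hω.integrableOn_Ioo.aestronglyMeasurable.aemeasurable.ennreal_ofReal (by fun_prop)]
  · refine setLIntegral_congr_fun measurableSet_Ioo fun r hr => ?_
    simp only [Pi.mul_apply]
    rw [ENNReal.ofReal_mul (pow_nonneg hr.1.le k), mul_comm]
  · filter_upwards [ae_restrict_mem measurableSet_Ioo] with s hs
    exact mul_nonneg (pow_nonneg hs.1.le k) (hω.nonneg hs)

lemma ae_mem_Ioo_toMeasure (ω : ℝ → ℝ) : ∀ᵐ r ∂toMeasure ω, r ∈ Ioo (0:ℝ) 1 :=
  (withDensity_absolutelyContinuous _ _).ae_le (ae_restrict_mem measurableSet_Ioo)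

/-- Moments of an upper doubling weight are doubling. -/
lemma momentW_le_momentW_two_mul (hω : IsRadialWeight ω) {D : ℝ} (hD0 : 0 < D)
    (hD : ∀ r ∈ Ico (0:ℝ) 1, omegaHat ω r ≤ D * omegaHat ω ((1 + r) / 2)) {k : ℕ} (hk : k ≠ 0) :
    momentW ω (k : ℝ) ≤ D * momentW ω ((2 * k : ℕ) : ℝ) := by
  have hnn : 0 ≤ momentW ω ((2 * k : ℕ) : ℝ) := by
    rw [momentW_natCast]
    exact hω.integral_mul_nonneg fun r hr => pow_nonneg hr.1.le _
  have hpow : ∀ l : ℕ, 0 ≤ᵐ[toMeasure ω] fun r : ℝ => r ^ l := fun l => by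
    filter_upwards [ae_mem_Ioo_toMeasure ω] with r hr using pow_nonneg hr.1.le l
  rw [← ENNReal.ofReal_le_ofReal_iff (by positivity), ENNReal.ofReal_mul hD0.le,
    ← hω.lintegral_pow_toMeasure, ← hω.lintegral_pow_toMeasure,
    lintegral_eq_lintegral_meas_le _ (hpow k) (by fun_prop),
    lintegral_eq_lintegral_meas_le _ (hpow (2 * k)) (by fun_prop),
    ← lintegral_const_mul' _ _ ENNReal.ofReal_ne_top]
  refine setLIntegral_mono' measurableSet_Ioi fun t (ht : 0 < t) => ?_
  rcases le_or_gt 1 t with ht1 | ht1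
  · have : toMeasure ω {a : ℝ | t ≤ a ^ k} = 0 := by
      rw [measure_eq_zero_iff_ae_notMem]
      filter_upwards [ae_mem_Ioo_toMeasure ω] with r hr hrt
      exact absurd (ht1.trans hrt) (not_le.2 (pow_lt_one₀ hr.1.le hr.2 hk))
    simp [this]
  · obtain ⟨s, hs, rfl⟩ : ∃ s ∈ Ioo (0:ℝ) 1, s ^ k = t := by
      refine ⟨t ^ ((k : ℝ)⁻¹), ⟨Real.rpow_pos_of_pos ht _, ?_⟩, ?_⟩
      · exact Real.rpow_lt_one ht.le ht1 (by positivity)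
      · exact Real.rpow_inv_natCast_pow ht.le hk
    have hs' : (1 + s) / 2 ∈ Ioo (0:ℝ) 1 := ⟨by linarith [hs.1], by linarith [hs.2]⟩
    calc toMeasure ω {a : ℝ | s ^ k ≤ a ^ k} ≤ toMeasure ω (Ico s 1) := by
          refine measure_mono_ae ?_
          filter_upwards [ae_mem_Ioo_toMeasure ω] with r hr hrs
          exact ⟨(pow_le_pow_iff_left₀ hs.1.le hr.1.le hk).1 hrs, hr.2⟩
      _ = ENNReal.ofReal (omegaHat ω s) := hω.toMeasure_Ico hs
      _ ≤ ENNReal.ofReal (D * omegaHat ω ((1 + s) / 2)) :=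
          ENNReal.ofReal_le_ofReal (hD s (Ioo_subset_Ico_self hs))
      _ = ENNReal.ofReal D * toMeasure ω (Ico ((1 + s) / 2) 1) := by
          rw [hω.toMeasure_Ico hs', ENNReal.ofReal_mul hD0.le]
      _ ≤ ENNReal.ofReal D * toMeasure ω {a : ℝ | s ^ k ≤ a ^ (2 * k)} := by
          gcongr
          intro r hr
          have h1 : s ≤ r ^ 2 := by nlinarith [hr.1, sq_nonneg (r - 1)]
          change s ^ k ≤ r ^ (2 * k)
          rw [pow_mul]
          exact pow_le_pow_left₀ hs.1.le h1 k

end IsRadialWeight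

lemma natCast_mul_pow_mul_one_sub_le {r : ℝ} (h0 : 0 ≤ r) (h1 : r ≤ 1) (N : ℕ) :
    N * (r ^ N * (1 - r)) ≤ 1 := by
  have h : (N : ℝ) * r ^ N ≤ ∑ i ∈ Finset.range N, r ^ i := by
    calc (N : ℝ) * r ^ N = ∑ _i ∈ Finset.range N, r ^ N := by simp
      _ ≤ _ := Finset.sum_le_sum fun i hi =>
        pow_le_pow_of_le_one h0 h1 (Finset.mem_range.1 hi).le
  calc N * (r ^ N * (1 - r)) = (N * r ^ N) * (1 - r) := by ring
    _ ≤ (∑ i ∈ Finset.range N, r ^ i) * (1 - r) :=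
      mul_le_mul_of_nonneg_right h (by linarith)
    _ = 1 - r ^ N := geom_sum_mul_neg r N
    _ ≤ 1 := by linarith [pow_nonneg h0 N]

lemma natCast_mul_pow_mul_one_sub_sq_le {r : ℝ} (h0 : 0 ≤ r) (h1 : r ≤ 1) (N : ℕ) :
    N * (r ^ N * (1 - r ^ 2)) ≤ 2 := by
  have h := natCast_mul_pow_mul_one_sub_le h0 h1 N
  calc N * (r ^ N * (1 - r ^ 2)) = (N * (r ^ N * (1 - r))) * (1 + r) := by ring
    _ ≤ 1 * (1 + r) := mul_le_mul_of_nonneg_right h (by linarith)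
    _ ≤ 2 := by linarith

lemma natCast_sq_mul_pow_mul_one_sub_sq_sq_le {r : ℝ} (h0 : 0 ≤ r) (h1 : r ≤ 1) (N : ℕ) :
    (N : ℝ) ^ 2 * (r ^ N * (1 - r ^ 2) ^ 2) ≤ 16 := by
  have hs1 : √r ≤ 1 := by simpa using h1
  have h := natCast_mul_pow_mul_one_sub_sq_le (Real.sqrt_nonneg r) hs1 N
  rw [Real.sq_sqrt h0] at h
  have hnn : 0 ≤ N * (√r ^ N * (1 - r)) := by
    have : 0 ≤ 1 - r := by linarith
    positivity
  calc (N : ℝ) ^ 2 * (r ^ N * (1 - r ^ 2) ^ 2)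
      = (N * (√r ^ N * (1 - r))) ^ 2 * (1 + r) ^ 2 := by
        rw [mul_pow, mul_pow, ← pow_mul, mul_comm N 2, pow_mul, Real.sq_sqrt h0]
        ring
    _ ≤ 2 ^ 2 * 2 ^ 2 := by gcongr; linarith
    _ = 16 := by norm_num

namespace IsRadialWeight

variable {ω : ℝ → ℝ}

lemma momentW_sub_eq (hω : IsRadialWeight ω) (k : ℕ) :
    momentW ω (k : ℝ) - momentW ω ((k + 2 : ℕ) : ℝ) =
      ∫ r in Ioo (0:ℝ) 1, (r ^ k * (1 - r ^ 2)) * ω r := by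
  rw [momentW_natCast, momentW_natCast, ← integral_sub (hω.integrableOn_mul (continuous_pow _))
    (hω.integrableOn_mul (continuous_pow _))]
  congr 1 with r
  ring

lemma momentW_second_difference_eq (hω : IsRadialWeight ω) (k : ℕ) :
    momentW ω (k : ℝ) - 2 * momentW ω ((k + 2 : ℕ) : ℝ) + momentW ω ((k + 4 : ℕ) : ℝ) =
      ∫ r in Ioo (0:ℝ) 1, (r ^ k * (1 - r ^ 2) ^ 2) * ω r := by
  have h : ∫ r in Ioo (0:ℝ) 1, (r ^ k * (1 - r ^ 2) ^ 2) * ω r =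
      (momentW ω (k : ℝ) - momentW ω ((k + 2 : ℕ) : ℝ)) -
        (momentW ω ((k + 2 : ℕ) : ℝ) - momentW ω ((k + 2 + 2 : ℕ) : ℝ)) := by
    rw [hω.momentW_sub_eq, hω.momentW_sub_eq, ← integral_sub
      (hω.integrableOn_mul (by fun_prop)) (hω.integrableOn_mul (by fun_prop))]
    congr 1 with r
    ring
  rw [h]
  ring

lemma momentW_sub_le (hω : IsRadialWeight ω) {N k : ℕ} (hk : 2 * N ≤ k) :
    N * (momentW ω (k : ℝ) - momentW ω ((k + 2 : ℕ) : ℝ)) ≤ 2 * momentW ω (N : ℝ) := by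
  rw [hω.momentW_sub_eq, momentW_natCast, ← integral_const_mul, ← integral_const_mul]
  simp only [← mul_assoc]
  refine hω.integral_mul_mono (by fun_prop) (by fun_prop) fun r hr => ?_
  have h0 := hr.1.le
  have h2 : 0 ≤ 1 - r ^ 2 := by nlinarith [hr.2]
  calc N * r ^ k * (1 - r ^ 2) ≤ N * r ^ (2 * N) * (1 - r ^ 2) := by
        gcongr N * ?_ * _
        exact pow_le_pow_of_le_one h0 hr.2.le hk
    _ = N * (r ^ N * (1 - r ^ 2)) * r ^ N := by ring
    _ ≤ 2 * r ^ N := by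
        gcongr
        exact natCast_mul_pow_mul_one_sub_sq_le h0 hr.2.le N

lemma momentW_second_difference_le (hω : IsRadialWeight ω) {N k : ℕ} (hk : 2 * N ≤ k) :
    (N : ℝ) ^ 2 * (momentW ω (k : ℝ) - 2 * momentW ω ((k + 2 : ℕ) : ℝ) +
      momentW ω ((k + 4 : ℕ) : ℝ)) ≤ 16 * momentW ω (N : ℝ) := by
  rw [hω.momentW_second_difference_eq, momentW_natCast, ← integral_const_mul, ← integral_const_mul]
  simp only [← mul_assoc]
  refine hω.integral_mul_mono (by fun_prop) (by fun_prop) fun r hr => ?_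
  have h0 := hr.1.le
  calc (N : ℝ) ^ 2 * r ^ k * (1 - r ^ 2) ^ 2 ≤ (N : ℝ) ^ 2 * r ^ (2 * N) * (1 - r ^ 2) ^ 2 := by
        gcongr _ * ?_ * _
        exact pow_le_pow_of_le_one h0 hr.2.le hk
    _ = (N : ℝ) ^ 2 * (r ^ N * (1 - r ^ 2) ^ 2) * r ^ N := by ring
    _ ≤ 16 * r ^ N := by
        gcongr
        exact natCast_sq_mul_pow_mul_one_sub_sq_sq_le h0 hr.2.le N

lemma momentW_second_difference_nonneg (hω : IsRadialWeight ω) (k : ℕ) :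
    0 ≤ momentW ω (k : ℝ) - 2 * momentW ω ((k + 2 : ℕ) : ℝ) + momentW ω ((k + 4 : ℕ) : ℝ) := by
  rw [hω.momentW_second_difference_eq]
  exact hω.integral_mul_nonneg fun r hr => by have := hr.1; positivity

end IsRadialWeight

lemma abs_inv_sub_inv_le {a b W ε : ℝ} (hW : 0 < W) (hb : W ≤ b) (hab : b ≤ a)
    (hε : a - b ≤ ε) : |a⁻¹ - b⁻¹| ≤ ε / W ^ 2 := by
  have hb0 : 0 < b := hW.trans_le hb
  have ha0 : 0 < a := hb0.trans_le hab
  have heq : a⁻¹ - b⁻¹ = -((a - b) / (a * b)) := by field_simp; ring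
  rw [heq, abs_neg, abs_of_nonneg (div_nonneg (by linarith) (by positivity)), sq]
  have : W * W ≤ a * b := mul_le_mul (hb.trans hab) hb hW.le ha0.le
  exact div_le_div₀ (by linarith) hε (by positivity) this

lemma abs_inv_second_difference_le {a b c W ε δ : ℝ} (hW : 0 < W) (hc : W ≤ c) (hbc : c ≤ b)
    (hab : b ≤ a) (hεa : a - b ≤ ε) (hεb : b - c ≤ ε) (hδ0 : 0 ≤ a - 2 * b + c)
    (hδ : a - 2 * b + c ≤ δ) :
    |a⁻¹ - 2 * b⁻¹ + c⁻¹| ≤ 2 * ε ^ 2 / W ^ 3 + δ / W ^ 2 := by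
  have hc0 : 0 < c := hW.trans_le hc
  have hb0 : 0 < b := hc0.trans_le hbc
  have ha0 : 0 < a := hb0.trans_le hab
  have heq : a⁻¹ - 2 * b⁻¹ + c⁻¹ =
      2 * ((a - b) * (b - c)) / (a * b * c) - (a - 2 * b + c) / (a * c) := by
    field_simp; ring
  have hac : W ^ 2 ≤ a * c := by
    rw [sq]; exact mul_le_mul (hc.trans (hbc.trans hab)) hc hW.le ha0.le
  have habc : W ^ 3 ≤ a * b * c := by
    calc W ^ 3 = W ^ 2 * W := by ring
      _ ≤ (a * c) * b := mul_le_mul hac (hc.trans hbc) hW.le (by positivity)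
      _ = a * b * c := by ring
  have hpq : (a - b) * (b - c) ≤ ε ^ 2 := by
    rw [sq]; exact mul_le_mul hεa hεb (by linarith) (by linarith)
  have hδ' : 0 ≤ δ := hδ0.trans hδ
  have hpq0 : 0 ≤ (a - b) * (b - c) := mul_nonneg (by linarith) (by linarith)
  rw [heq]
  refine (abs_sub _ _).trans ?_
  rw [abs_of_nonneg (by positivity), abs_of_nonneg (by positivity)]
  gcongr

namespace IsRadialWeight

variable {ω : ℝ → ℝ}

lemma momentW_le_pow_mul (hω : IsRadialWeight ω) {D : ℝ} (hD0 : 0 < D)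
    (hD : ∀ r ∈ Ico (0:ℝ) 1, omegaHat ω r ≤ D * omegaHat ω ((1 + r) / 2)) {k : ℕ} (hk : k ≠ 0)
    (i : ℕ) : momentW ω (k : ℝ) ≤ D ^ i * momentW ω ((2 ^ i * k : ℕ) : ℝ) := by
  induction i with
  | zero => simp
  | succ i ih =>
    have h := hω.momentW_le_momentW_two_mul hD0 hD (k := 2 ^ i * k) (by positivity)
    calc momentW ω (k : ℝ) ≤ D ^ i * momentW ω ((2 ^ i * k : ℕ) : ℝ) := ih
      _ ≤ D ^ i * (D * momentW ω ((2 * (2 ^ i * k) : ℕ) : ℝ)) := by gcongr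
      _ = D ^ (i + 1) * momentW ω ((2 ^ (i + 1) * k : ℕ) : ℝ) := by
        rw [← mul_assoc, ← mul_assoc, ← pow_succ, ← pow_succ']

/-- On frequencies comparable to `N`, the reciprocals of the odd moments form an `L¹` multiplier. -/
lemma isL1Multiplier_inv_momentW (hω : IsRadialWeight ω)
    (hpos : ∀ r ∈ Ico (0:ℝ) 1, 0 < omegaHat ω r) {D : ℝ} (hD0 : 0 < D)
    (hD : ∀ r ∈ Ico (0:ℝ) 1, omegaHat ω r ≤ D * omegaHat ω ((1 + r) / 2)) {N : ℕ} (hN : N ≠ 0) :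
    IsL1Multiplier (Finset.Icc N (4 * N - 1)) (fun j => (momentW ω ((2 * j + 1 : ℕ) : ℝ))⁻¹)
      ((1 + 200 * D ^ 4 + 96 * D ^ 8) / momentW ω ((16 * N : ℕ) : ℝ)) := by
  set W := momentW ω ((16 * N : ℕ) : ℝ) with hW
  set A := momentW ω (N : ℝ) with hA
  set w : ℕ → ℝ := fun j => momentW ω ((2 * j + 1 : ℕ) : ℝ) with hw
  have hW0 : 0 < W := hω.momentW_pos hpos _
  have hA0 : 0 < A := hω.momentW_pos hpos _
  have hAW : A ≤ D ^ 4 * W := hω.momentW_le_pow_mul hD0 hD hN 4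
  have hN0 : (0 : ℝ) < N := by positivity
  have hWw : ∀ j ≤ 4 * N + 1, W ≤ w j := fun j hj => hω.momentW_antitone (by omega)
  have hanti : ∀ j, w (j + 1) ≤ w j := fun j => hω.momentW_antitone (by omega)
  have hfirst : ∀ j, N ≤ j → w j - w (j + 1) ≤ 2 * A / N := fun j hj => by
    rw [le_div_iff₀' hN0]
    exact hω.momentW_sub_le (k := 2 * j + 1) (by omega)
  have hsecond : ∀ j, N ≤ j → w j - 2 * w (j + 1) + w (j + 2) ≤ 16 * A / (N : ℝ) ^ 2 :=
    fun j hj => by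
      rw [le_div_iff₀' (by positivity)]
      exact hω.momentW_second_difference_le (k := 2 * j + 1) (by omega)
  have hsecond0 : ∀ j, 0 ≤ w j - 2 * w (j + 1) + w (j + 2) := fun j =>
    hω.momentW_second_difference_nonneg (2 * j + 1)
  have hM : 4 * N - 1 + 1 = 4 * N := by omega
  have key := isL1Multiplier_of_second_difference (fun j => (w j)⁻¹) N (4 * N - 1)
    (Finset.Icc_subset_Icc_right (Nat.le_succ (4 * N - 1)))
  have hcast : ((4 * N - 1 : ℕ) : ℝ) + 1 = 4 * N := by
    rw [← Nat.cast_add_one, hM]; push_cast; rfl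
  refine key.mono ?_
  rw [hcast, hM, show 4 * N - 1 + 2 = 4 * N + 1 by omega]
  have h1 : |(w (4 * N))⁻¹| ≤ 1 / W := by
    have := hWw (4 * N) (by omega)
    rw [abs_of_nonneg (inv_nonneg.2 (hW0.le.trans this)), one_div]
    exact inv_anti₀ hW0 this
  have h2 : |(w (4 * N))⁻¹ - (w (4 * N + 1))⁻¹| * (4 * N) ≤ 8 * D ^ 4 / W := by
    calc |(w (4 * N))⁻¹ - (w (4 * N + 1))⁻¹| * (4 * N)
        ≤ (2 * A / N) / W ^ 2 * (4 * N) := by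
          gcongr
          exact abs_inv_sub_inv_le hW0 (hWw _ le_rfl) (hanti _) (hfirst _ (by omega))
      _ = 8 * A / W ^ 2 := by field_simp; ring
      _ ≤ 8 * (D ^ 4 * W) / W ^ 2 := by gcongr
      _ = 8 * D ^ 4 / W := by field_simp
  have h3 : ∀ k ∈ Finset.Ico N (4 * N),
      |(w k)⁻¹ - 2 * (w (k + 1))⁻¹ + (w (k + 2))⁻¹| * (k + 1) ≤
        (32 * D ^ 8 + 64 * D ^ 4) / W / N := by
    intro k hk
    rw [Finset.mem_Ico] at hk
    have hk1 : (k : ℝ) + 1 ≤ 4 * N := by exact_mod_cast hk.2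
    calc |(w k)⁻¹ - 2 * (w (k + 1))⁻¹ + (w (k + 2))⁻¹| * (k + 1)
        ≤ (2 * (2 * A / N) ^ 2 / W ^ 3 + (16 * A / (N : ℝ) ^ 2) / W ^ 2) * (4 * N) := by
          gcongr
          exact abs_inv_second_difference_le hW0 (hWw _ (by omega)) (hanti _) (hanti _)
            (hfirst _ hk.1) (hfirst _ (by omega)) (hsecond0 _) (hsecond _ hk.1)
      _ = (32 * A ^ 2 / W ^ 3 + 64 * A / W ^ 2) / N := by field_simp; ring
      _ ≤ (32 * (D ^ 4 * W) ^ 2 / W ^ 3 + 64 * (D ^ 4 * W) / W ^ 2) / N := by gcongr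
      _ = (32 * D ^ 8 + 64 * D ^ 4) / W / N := by field_simp
  have h4 := Finset.sum_le_card_nsmul _ _ _ h3
  rw [Nat.card_Ico, nsmul_eq_mul, show 4 * N - N = 3 * N by omega] at h4
  have h5 : ((3 * N : ℕ) : ℝ) * ((32 * D ^ 8 + 64 * D ^ 4) / W / N) =
      (96 * D ^ 8 + 192 * D ^ 4) / W := by
    push_cast; field_simp; ring
  rw [h5] at h4
  calc _ ≤ 1 / W + 8 * D ^ 4 / W + (96 * D ^ 8 + 192 * D ^ 4) / W := by gcongr
    _ = _ := by ring

end IsRadialWeight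

lemma MpE_one_eq {r : ℝ} {f : ℂ → ℂ} (hf : Continuous fun θ => f (circlePt r θ)) :
    MpE 1 r f = ENNReal.ofReal (1 / (2 * Real.pi)) *
      ENNReal.ofReal (periodL1 fun θ => f (circlePt r θ)) := by
  simp only [MpE, Real.rpow_one, div_one, ENNReal.rpow_one, periodL1]
  rw [intervalIntegral.integral_of_le (by positivity), integral_Ioc_eq_integral_Ioo,
    ofReal_integral_eq_lintegral_ofReal _ (ae_of_all _ fun _ => norm_nonneg _)]
  exact (hf.norm.integrableOn_Icc).mono_set Ioo_subset_Icc_self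

lemma circlePt_pow (r θ : ℝ) (j : ℕ) :
    circlePt r θ ^ j = (r : ℂ) ^ j * Complex.exp (j * (θ * Complex.I)) := by
  rw [circlePt, mul_pow, Complex.exp_nat_mul]

/-- An `L¹` multiplier of trigonometric polynomials is bounded in the Hardy norm `H¹`. -/
lemma H1NormE_sum_le {s : Finset ℕ} {c : ℕ → ℝ} {B : ℝ} (hB : 0 ≤ B) (hc : IsL1Multiplier s c B)
    (a : ℕ → ℂ) :
    H1NormE (fun z => ∑ j ∈ s, c j * a j * z ^ j) ≤
      ENNReal.ofReal B * H1NormE (fun z => ∑ j ∈ s, a j * z ^ j) := by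
  have htrig : ∀ (b : ℕ → ℂ) (r : ℝ), (fun θ => ∑ j ∈ s, b j * circlePt r θ ^ j) =
      trigPoly s fun j => b j * r ^ j := fun b r => by
    funext θ
    simp only [trigPoly, circlePt_pow, mul_assoc]
  have hmean : ∀ (b : ℕ → ℂ) (r : ℝ), MpE 1 r (fun z => ∑ j ∈ s, b j * z ^ j) =
      ENNReal.ofReal (1 / (2 * Real.pi)) *
        ENNReal.ofReal (periodL1 (trigPoly s fun j => b j * r ^ j)) := fun b r => by
    rw [MpE_one_eq (by rw [htrig]; exact continuous_trigPoly _ _), htrig]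
  refine iSup₂_le fun r hr => ?_
  calc MpE 1 r (fun z => ∑ j ∈ s, c j * a j * z ^ j)
      ≤ ENNReal.ofReal B * MpE 1 r (fun z => ∑ j ∈ s, a j * z ^ j) := by
        rw [hmean, hmean, mul_left_comm, ← ENNReal.ofReal_mul hB]
        gcongr
        simp only [mul_assoc]
        exact hc _
    _ ≤ _ := by
        gcongr
        exact le_iSup₂ (f := fun r (_ : r ∈ Ioo (0:ℝ) 1) =>
          MpE 1 r fun z => ∑ j ∈ s, a j * z ^ j) r hr

/-- For `ω ∈ D̂`, `‖D^ω(V_n∗g)‖_{H¹} ≲ (ω_{2^{n+2}})^{-1} ‖V_n∗g‖_{H¹}`. -/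
theorem Domega_Vn_estimate
    (ω : ℝ → ℝ) (hω : IsRadialWeight ω)
    (hpos : ∀ r ∈ Set.Ico (0:ℝ) 1, 0 < omegaHat ω r)
    (hD : InDhat ω)
    (Ψ : ℝ → ℝ) (hΨsmooth : ContDiff ℝ (⊤ : ℕ∞) Ψ)
    (hΨ1 : ∀ x : ℝ, x ≤ 1 → Ψ x = 1)
    (hΨ0 : ∀ x : ℝ, 2 ≤ x → Ψ x = 0)
    (hΨdec : StrictAntiOn Ψ (Set.Ioo (1:ℝ) 2))
    (hΨpos : ∀ x ∈ Set.Ioo (1:ℝ) 2, 0 < Ψ x) :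
    ∃ C > (0:ℝ), ∀ n : ℕ, 1 ≤ n → ∀ g : ℂ → ℂ,
      DifferentiableOn ℂ g (Metric.ball 0 1) →
      H1NormE (DVnStar Ψ ω n g) ≤
        ENNReal.ofReal (C / momentW ω ((2:ℝ) ^ (n + 2))) * H1NormE (VnStar Ψ n g) := by
  obtain ⟨D, hD0, hD⟩ := hD
  refine ⟨D * (1 + 200 * D ^ 4 + 96 * D ^ 8), by positivity, fun n hn g _ => ?_⟩
  obtain ⟨n, rfl⟩ : ∃ k, n = k + 1 := ⟨n - 1, by omega⟩
  have hlast : 2 ^ (n + 1 + 1) - 1 = 4 * 2 ^ n - 1 := by rw [pow_succ, pow_succ]; omega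
  have hmult := (hω.isL1Multiplier_inv_momentW hpos hD0 hD (N := 2 ^ n) (by positivity)).const_mul
    (1 / 2)
  have h16 : 0 < momentW ω ((16 * 2 ^ n : ℕ) : ℝ) := hω.momentW_pos hpos _
  have h8 : 0 < momentW ω ((8 * 2 ^ n : ℕ) : ℝ) := hω.momentW_pos hpos _
  have hdouble : momentW ω ((8 * 2 ^ n : ℕ) : ℝ) ≤ D * momentW ω ((16 * 2 ^ n : ℕ) : ℝ) := by
    have h := hω.momentW_le_momentW_two_mul hD0 hD (k := 8 * 2 ^ n) (by positivity)
    rwa [← mul_assoc] at h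
  have hbound : |(1 / 2 : ℝ)| * ((1 + 200 * D ^ 4 + 96 * D ^ 8) /
      momentW ω ((16 * 2 ^ n : ℕ) : ℝ)) ≤
      D * (1 + 200 * D ^ 4 + 96 * D ^ 8) / momentW ω ((8 * 2 ^ n : ℕ) : ℝ) := by
    rw [abs_of_pos (by norm_num), ← mul_div_assoc, div_le_div_iff₀ h16 h8]
    have h := mul_le_mul_of_nonneg_left hdouble
      (by positivity : 0 ≤ 1 + 200 * D ^ 4 + 96 * D ^ 8)
    have h0 : 0 ≤ (1 + 200 * D ^ 4 + 96 * D ^ 8) * momentW ω ((8 * 2 ^ n : ℕ) : ℝ) := by positivity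
    linarith
  have hpow : ((2:ℝ) ^ (n + 1 + 2)) = ((8 * 2 ^ n : ℕ) : ℝ) := by push_cast; ring
  have hH := H1NormE_sum_le (by positivity) (hmult.mono hbound) fun j =>
    (((Ψ ((j:ℝ) / 2 ^ (n + 1)) - Ψ ((j:ℝ) / 2 ^ n)) : ℝ) : ℂ) * taylorCoeff g j
  rw [hpow]
  convert hH using 2
  · funext z
    simp only [DVnStar, Nat.add_sub_cancel, hlast]
    refine Finset.sum_congr rfl fun j _ => ?_
    push_cast
    rw [div_eq_mul_inv, mul_inv]
    ring
  · unfold VnStar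
    rw [Nat.add_sub_cancel, hlast]
end
end
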